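/- arXiv:2107.10385 — 3 statements merged into one kernel-verified Lean document; each statement's English description precedes it below -/
import Mathlib

section
/- Let k₁,…,kₙ be positive integers and let G = {0,…,k₁-1}×⋯×{0,…,kₙ-1} ⊆ ℝⁿ. If P ∈ ℝ[X₁,…,Xₙ] and a ∈ G are such that P(x) = 0 for all x ∈ G with x ≠ a, and P(a) ≠ 0, then the total degree of P satisfies deg P ≥ Σᵢ₌₁ⁿ (kᵢ - 1). -/
open MvPolynomial

noncomputable section

namespace CoveringSymmetric

/-- `N = ∑ᵢ (kᵢ - 1)` for the uniform grid `[0,k₁-1] × ⋯ × [0,kₙ-1]`. -/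
def Ntot (n : ℕ) (k : Fin n → ℕ) : ℕ := ∑ i, (k i - 1)

/-- The integer points of the uniform grid `G = [0,k₁-1] × ⋯ × [0,kₙ-1]`. -/
def gridSet (n : ℕ) (k : Fin n → ℕ) : Set (Fin n → ℕ) := {x | ∀ i, x i < k i}

/-- The real point of `ℝⁿ` corresponding to an integer point. -/
def toR {n : ℕ} (x : Fin n → ℕ) : Fin n → ℝ := fun i => (x i : ℝ)

/-- The weight `wt(x) = ∑ᵢ xᵢ` of a point. -/
def wt {n : ℕ} (x : Fin n → ℕ) : ℕ := ∑ i, x i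

/-- The weight-determined set `E̲ = {x ∈ G : wt(x) ∈ E}`. -/
def wdSet (n : ℕ) (k : Fin n → ℕ) (E : Finset ℕ) : Set (Fin n → ℕ) :=
  {x ∈ gridSet n k | wt x ∈ E}

/-- The layer `j̲ = {x ∈ G : wt(x) = j}`. -/
def layer (n : ℕ) (k : Fin n → ℕ) (j : ℕ) : Set (Fin n → ℕ) :=
  {x ∈ gridSet n k | wt x = j}

/-- The grid is strictly unimodal (SU²):
`|0̲| < ⋯ < |⌊N/2⌋̲| = |⌈N/2⌉̲| > ⋯ > |N̲|`. -/
def SU2 (n : ℕ) (k : Fin n → ℕ) : Prop :=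
  (∀ j, j < Ntot n k / 2 → (layer n k j).ncard < (layer n k (j + 1)).ncard) ∧
  (layer n k (Ntot n k / 2)).ncard = (layer n k ((Ntot n k + 1) / 2)).ncard ∧
  (∀ j, (Ntot n k + 1) / 2 ≤ j → j < Ntot n k →
    (layer n k (j + 1)).ncard < (layer n k j).ncard)

/-- The zero set `Z_G(P)` of a polynomial within the grid. -/
def ZG (n : ℕ) (k : Fin n → ℕ) (P : MvPolynomial (Fin n) ℝ) : Set (Fin n → ℕ) :=
  {x ∈ gridSet n k | eval (toR x) P = 0}

/-- The degree-`d` Zariski closure of `S ⊆ G` within the grid. -/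
def Zcl (n : ℕ) (k : Fin n → ℕ) (d : ℕ) (S : Set (Fin n → ℕ)) : Set (Fin n → ℕ) :=
  {a ∈ gridSet n k | ∀ P : MvPolynomial (Fin n) ℝ, P.totalDegree ≤ d →
    (∀ x ∈ S, eval (toR x) P = 0) → eval (toR a) P = 0}

/-- The degree-`d` Z*-closure of a weight-determined set, as a set of weights:
`{j ∈ [0,N] : j̲ ⊆ Z-cl_{G,d}(E̲)}`. -/
def Zstar (n : ℕ) (k : Fin n → ℕ) (d : ℕ) (E : Finset ℕ) : Set ℕ :=
  {j | j ≤ Ntot n k ∧ layer n k j ⊆ Zcl n k d (wdSet n k E)}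

/-- `PC_G(E)`: minimum total degree of a nontrivial polynomial cover of `E̲`. -/
def PC (n : ℕ) (k : Fin n → ℕ) (E : Finset ℕ) : ℕ :=
  sInf {d | ∃ P : MvPolynomial (Fin n) ℝ, P.totalDegree = d ∧
    wdSet n k E ⊆ ZG n k P ∧ ZG n k P ≠ gridSet n k}

/-- `PPC_G(E)`: minimum total degree of a proper polynomial cover of `E̲`. -/
def PPC (n : ℕ) (k : Fin n → ℕ) (E : Finset ℕ) : ℕ :=
  sInf {d | ∃ P : MvPolynomial (Fin n) ℝ, P.totalDegree = d ∧
    wdSet n k E ⊆ ZG n k P ∧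
    ∀ j ≤ Ntot n k, j ∉ E → ¬ (layer n k j ⊆ ZG n k P)}

/-- `EPC_G(E)`: minimum total degree of an exact polynomial cover of `E̲`. -/
def EPC (n : ℕ) (k : Fin n → ℕ) (E : Finset ℕ) : ℕ :=
  sInf {d | ∃ P : MvPolynomial (Fin n) ℝ, P.totalDegree = d ∧ ZG n k P = wdSet n k E}

/-- `x` lies on the affine hyperplane `{y ∈ ℝⁿ : ∑ᵢ wᵢ yᵢ = c}` (with `w ≠ 0`). -/
def onHyp {n : ℕ} (w : Fin n → ℝ) (c : ℝ) (x : Fin n → ℕ) : Prop :=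
  ∑ i, w i * (x i : ℝ) = c

/-- `HC_G(E)`: minimum size of a nontrivial hyperplane cover of `E̲`. -/
def HC (n : ℕ) (k : Fin n → ℕ) (E : Finset ℕ) : ℕ :=
  sInf {m | ∃ (w : Fin m → Fin n → ℝ) (c : Fin m → ℝ), (∀ t, w t ≠ 0) ∧
    (∀ x ∈ wdSet n k E, ∃ t, onHyp (w t) (c t) x) ∧
    ∃ x ∈ gridSet n k, ∀ t, ¬ onHyp (w t) (c t) x}

/-- `PHC_G(E)`: minimum size of a proper hyperplane cover of `E̲`. -/
def PHC (n : ℕ) (k : Fin n → ℕ) (E : Finset ℕ) : ℕ :=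
  sInf {m | ∃ (w : Fin m → Fin n → ℝ) (c : Fin m → ℝ), (∀ t, w t ≠ 0) ∧
    (∀ x ∈ wdSet n k E, ∃ t, onHyp (w t) (c t) x) ∧
    ∀ j ≤ Ntot n k, j ∉ E → ¬ (layer n k j ⊆ {x | ∃ t, onHyp (w t) (c t) x})}

/-- The certifying degree of `S ⊆ G`: least `d ∈ [0,N]` such that some polynomial of
total degree at most `d` is nonconstant on `G` but constant on `S`. -/
def certDeg (n : ℕ) (k : Fin n → ℕ) (S : Set (Fin n → ℕ)) : ℕ :=
  sInf {d | d ≤ Ntot n k ∧ ∃ f : MvPolynomial (Fin n) ℝ, f.totalDegree ≤ d ∧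
    (∃ a ∈ gridSet n k, ∃ b ∈ gridSet n k, eval (toR a) f ≠ eval (toR b) f) ∧
    ∀ a ∈ S, ∀ b ∈ S, eval (toR a) f = eval (toR b) f}

/-- `T_{N,i} = [0,i-1] ∪ [N-i+1,N]` (so `T_{N,0} = ∅`). -/
def T (N i : ℕ) : Finset ℕ := Finset.range i ∪ Finset.Icc (N - i + 1) N

/-- `E` is `(d,i)`-admitting: `E ∪ T_{N,i} ≠ [0,N]` and `|E \ T_{N,i}| ≤ d - i`. -/
def Admitting (N d i : ℕ) (E : Finset ℕ) : Prop :=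
  E ∪ T N i ≠ Finset.range (N + 1) ∧ (E \ T N i).card ≤ d - i

/-- `E` is `d`-admitting: `(d,i)`-admitting for some `i ∈ [0,d]`. -/
def DAdmitting (N d : ℕ) (E : Finset ℕ) : Prop :=
  ∃ i ≤ d, Admitting N d i E

/-- The operator `L_{N,d}`: if `E = {t₁ < ⋯ < t_s}` with `s ≥ d+1`, then
`L_{N,d}(E) = [0, t_{s-d}] ∪ E ∪ [t_{d+1}, N]`, and `L_{N,d}(E) = E` if `s ≤ d`.
(For `E ⊆ [0,N]`, `j ≤ t_{s-d}` iff `E` has at least `d+1` elements `≥ j`, and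
`t_{d+1} ≤ j` iff `E` has at least `d+1` elements `≤ j`.) -/
def Lop (N d : ℕ) (E : Finset ℕ) : Finset ℕ :=
  E ∪ (Finset.range (N + 1)).filter fun j =>
    d + 1 ≤ (E.filter fun t => j ≤ t).card ∨ d + 1 ≤ (E.filter fun t => t ≤ j).card

/-- `L̄_{N,d}(E) = ⋃ₘ L_{N,d}^m(E)`, the union of all iterates of `L_{N,d}` on `E`. -/
def Lbar (N d : ℕ) (E : Finset ℕ) : Set ℕ :=
  ⋃ m : ℕ, ((Lop N d)^[m] E : Set ℕ)

/-- `P` is a (possibly empty) product of polynomials of total degree at most 1. -/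
def ProdLinear (n : ℕ) (P : MvPolynomial (Fin n) ℝ) : Prop :=
  ∃ (m : ℕ) (ℓ : Fin m → MvPolynomial (Fin n) ℝ),
    (∀ t, (ℓ t).totalDegree ≤ 1) ∧ P = ∏ t, ℓ t

/-- The degree-`d` h-closure of `S ⊆ G`. -/
def hcl (n : ℕ) (k : Fin n → ℕ) (d : ℕ) (S : Set (Fin n → ℕ)) : Set (Fin n → ℕ) :=
  {a ∈ gridSet n k | ∀ P : MvPolynomial (Fin n) ℝ, ProdLinear n P → P.totalDegree ≤ d →
    (∀ x ∈ S, eval (toR x) P = 0) → eval (toR a) P = 0}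

/-- A weighted sum over a finite grid which annihilates every polynomial of total degree less than
`∑ i, (#(S i) - 1)`, the weights being products of Lagrange nodal weights. -/
lemma sum_piFinset_eval_mul_prod_inv_eq_zero {σ F : Type*} [Fintype σ] [DecidableEq σ]
    [Field F] [DecidableEq F] (S : σ → Finset F) (P : MvPolynomial σ F)
    (hP : P.totalDegree < ∑ i, ((S i).card - 1)) :
    ∑ x ∈ Fintype.piFinset S, eval x P * ∏ i, (∏ y ∈ (S i).erase (x i), (x i - y))⁻¹ = 0 := by
  simp only [eval_eq', Finset.sum_mul]
  rw [Finset.sum_comm]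
  refine Finset.sum_eq_zero fun d hd => ?_
  have hd_lt : ∑ i, d i < ∑ i, ((S i).card - 1) := by
    refine lt_of_le_of_lt ?_ hP
    simpa [Finsupp.sum_fintype] using le_totalDegree hd
  obtain ⟨i, -, hi⟩ := Finset.exists_lt_of_sum_lt hd_lt
  have hzero : ∑ y ∈ S i, y ^ d i * (∏ z ∈ (S i).erase y, (y - z))⁻¹ = 0 := by
    have h := Lagrange.coeff_eq_sum (s := S i) (v := id) (Set.injOn_id _)
      (P := Polynomial.X ^ d i) (by
        rw [Polynomial.degree_X_pow]
        exact_mod_cast (by omega : d i < (S i).card))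
    rw [Polynomial.coeff_X_pow, if_neg hi.ne'] at h
    simpa [div_eq_mul_inv] using h.symm
  simp only [mul_assoc, ← Finset.prod_mul_distrib, ← Finset.mul_sum]
  rw [← Finset.prod_univ_sum S fun i y => y ^ d i * (∏ z ∈ (S i).erase y, (y - z))⁻¹,
    Finset.prod_eq_zero (Finset.mem_univ i) hzero, mul_zero]

/-- **Alon–Füredi** for an arbitrary finite grid over a field. -/
lemma sum_card_sub_one_le_totalDegree {σ F : Type*} [Fintype σ] [Field F] (S : σ → Finset F)
    (P : MvPolynomial σ F) (a : σ → F) (ha : ∀ i, a i ∈ S i)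
    (hvanish : ∀ x, (∀ i, x i ∈ S i) → x ≠ a → eval x P = 0) (hnz : eval a P ≠ 0) :
    ∑ i, ((S i).card - 1) ≤ P.totalDegree := by
  classical
  by_contra! hlt
  have h := sum_piFinset_eval_mul_prod_inv_eq_zero S P hlt
  rw [Finset.sum_eq_single_of_mem a (Fintype.mem_piFinset.2 ha) fun x hx hxa => by
    rw [hvanish x (Fintype.mem_piFinset.1 hx) hxa, zero_mul]] at h
  refine mul_ne_zero hnz (Finset.prod_ne_zero_iff.2 fun i _ => inv_ne_zero ?_) h
  exact Finset.prod_ne_zero_iff.2 fun y hy => sub_ne_zero.2 (Finset.ne_of_mem_erase hy).symm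

/-- Alon–Füredi: if `P` vanishes on every point of the grid except `a`,
then `deg P ≥ ∑ᵢ (kᵢ - 1)`. -/
theorem stmt0 (n : ℕ) (k : Fin n → ℕ) (hk : ∀ i, 1 ≤ k i)
    (P : MvPolynomial (Fin n) ℝ) (a : Fin n → ℕ) (ha : a ∈ gridSet n k)
    (hvanish : ∀ x ∈ gridSet n k, x ≠ a → eval (toR x) P = 0)
    (hnz : eval (toR a) P ≠ 0) :
    Ntot n k ≤ P.totalDegree := by
  have h := sum_card_sub_one_le_totalDegree
    (fun i => (Finset.range (k i)).map (Nat.castEmbedding (R := ℝ))) P (toR a)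
    (fun i => Finset.mem_map_of_mem _ (Finset.mem_range.2 (ha i))) (fun x hx hxa => ?_) hnz
  · simpa [Ntot] using h
  · simp only [Finset.mem_map, Finset.mem_range, Nat.castEmbedding_apply] at hx
    choose y hy hyx using hx
    obtain rfl : toR y = x := funext hyx
    exact hvanish y hy fun hya => hxa (congrArg toR hya)

end CoveringSymmetric
end
end

section
/- Let G be an SU² grid and let E ⊊ {0,…,N}. Then PC_G(E) = min{d ∈ {0,…,N} : E is d-admitting}. -/
open MvPolynomial

noncomputable section

namespace CoveringSymmetric

/-- The weight raising operator `(U f)(x) = ∑ₗ xₗ f(x - eₗ)`. -/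
def raiseOp (n : ℕ) : Module.End ℝ ((Fin n → ℕ) → ℝ) where
  toFun f x := ∑ l, (x l : ℝ) * f (x - Pi.single l 1)
  map_add' f g := by
    ext x
    simp [mul_add, Finset.sum_add_distrib]
  map_smul' c f := by
    ext x
    simp only [Pi.smul_apply, smul_eq_mul, RingHom.id_apply, Finset.mul_sum]
    exact Finset.sum_congr rfl fun l _ => by ring

/-- The weight lowering operator `(D f)(x) = ∑ₗ (kₗ - 1 - xₗ) f(x + eₗ)`. -/
def lowerOp (n : ℕ) (k : Fin n → ℕ) : Module.End ℝ ((Fin n → ℕ) → ℝ) where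
  toFun f x := ∑ l, ((k l : ℝ) - 1 - x l) * f (x + Pi.single l 1)
  map_add' f g := by
    ext x
    simp [mul_add, Finset.sum_add_distrib]
  map_smul' c f := by
    ext x
    simp only [Pi.smul_apply, smul_eq_mul, RingHom.id_apply, Finset.mul_sum]
    exact Finset.sum_congr rfl fun l _ => by ring

theorem raiseOp_apply {n : ℕ} (f : (Fin n → ℕ) → ℝ) (x : Fin n → ℕ) :
    raiseOp n f x = ∑ l, (x l : ℝ) * f (x - Pi.single l 1) := rfl

theorem lowerOp_apply {n : ℕ} (k : Fin n → ℕ) (f : (Fin n → ℕ) → ℝ) (x : Fin n → ℕ) :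
    lowerOp n k f x = ∑ l, ((k l : ℝ) - 1 - x l) * f (x + Pi.single l 1) := rfl

theorem wt_add_single {n : ℕ} (x : Fin n → ℕ) (l : Fin n) :
    wt (x + Pi.single l 1) = wt x + 1 := by
  simp [wt, Finset.sum_add_distrib]

theorem sub_single_add_single {n : ℕ} {x : Fin n → ℕ} {l : Fin n} (h : x l ≠ 0) :
    x - Pi.single l 1 + Pi.single l 1 = x := by
  ext m
  rcases eq_or_ne m l with rfl | hm
  · simp; omega
  · simp [hm]

theorem wt_sub_single {n : ℕ} {x : Fin n → ℕ} {l : Fin n} (h : x l ≠ 0) :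
    wt (x - Pi.single l 1) + 1 = wt x := by
  rw [← wt_add_single, sub_single_add_single h]

theorem wt_cast {n : ℕ} (x : Fin n → ℕ) : (wt x : ℝ) = ∑ l, (x l : ℝ) := by
  simp [wt]

theorem Ntot_cast {n : ℕ} {k : Fin n → ℕ} (hk : ∀ l, 1 ≤ k l) :
    (Ntot n k : ℝ) = ∑ l, ((k l : ℝ) - 1) := by
  simp only [Ntot, Nat.cast_sum]
  exact Finset.sum_congr rfl fun l _ => by rw [Nat.cast_sub (hk l), Nat.cast_one]

theorem lowerOp_raiseOp {n : ℕ} {k : Fin n → ℕ} (hk : ∀ l, 1 ≤ k l)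
    (f : (Fin n → ℕ) → ℝ) (x : Fin n → ℕ) :
    lowerOp n k (raiseOp n f) x =
      raiseOp n (lowerOp n k f) x + ((Ntot n k : ℝ) - 2 * wt x) * f x := by
  have hterm : ∀ l m : Fin n,
      ((k l : ℝ) - 1 - x l) * (((x + Pi.single l 1 : Fin n → ℕ) m : ℕ) * f (x + Pi.single l 1 - Pi.single m 1))
      = (x m : ℝ) * (((k l : ℝ) - 1 - ((x - Pi.single m 1 : Fin n → ℕ) l : ℕ)) *
          f (x - Pi.single m 1 + Pi.single l 1))
        + if l = m then ((k l : ℝ) - 1 - 2 * x l) * f x else 0 := by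
    intro l m
    rcases eq_or_ne l m with rfl | hlm
    · rw [if_pos rfl, add_tsub_cancel_right]
      rcases eq_or_ne (x l) 0 with h0 | h0
      · simp [h0]
      · rw [sub_single_add_single h0]
        have : ((x - Pi.single l 1 : Fin n → ℕ) l : ℝ) = x l - 1 := by
          simp [Nat.cast_sub (Nat.one_le_iff_ne_zero.mpr h0)]
        rw [this]
        simp
        ring
    · rw [if_neg hlm, add_zero]
      rcases eq_or_ne (x m) 0 with h0 | h0
      · simp [h0, hlm.symm]
      · have : x + Pi.single l 1 - Pi.single m 1 = x - Pi.single m 1 + Pi.single l 1 := by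
          ext t
          rcases eq_or_ne t m with rfl | ht
          · simp [hlm.symm]
          · simp [ht]
        rw [this]
        simp [hlm, hlm.symm]
        ring
  have hN : ((Ntot n k : ℝ) - 2 * wt x) * f x
      = ∑ l, ((k l : ℝ) - 1 - 2 * x l) * f x := by
    rw [Ntot_cast hk, wt_cast, Finset.mul_sum, ← Finset.sum_sub_distrib, Finset.sum_mul]
  simp only [lowerOp_apply, raiseOp_apply, Finset.mul_sum]
  rw [hN, Finset.sum_congr rfl fun l _ => Finset.sum_congr rfl fun m _ => hterm l m]
  simp only [Finset.sum_add_distrib, Finset.sum_ite_eq, Finset.mem_univ, if_true]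
  rw [Finset.sum_comm]

/-- Replacing `x` by `x + eₗ` changes a single factor of a product over the coordinates. -/
theorem prod_add_single {n : ℕ} (φ : Fin n → ℕ → ℝ) (x : Fin n → ℕ) (l : Fin n) {a b : ℝ}
    (h : φ l (x l + 1) * a = φ l (x l) * b) :
    (∏ m, φ m ((x + Pi.single l 1 : Fin n → ℕ) m)) * a = (∏ m, φ m (x m)) * b := by
  rw [← Finset.mul_prod_erase _ _ (Finset.mem_univ l),
    ← Finset.mul_prod_erase Finset.univ (fun m => φ m (x m)) (Finset.mem_univ l)]
  have : ∏ m ∈ Finset.univ.erase l, φ m ((x + Pi.single l 1 : Fin n → ℕ) m)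
      = ∏ m ∈ Finset.univ.erase l, φ m (x m) :=
    Finset.prod_congr rfl fun m hm => by simp [Finset.ne_of_mem_erase hm]
  rw [this]
  simp only [Pi.add_apply, Pi.single_eq_same]
  linear_combination (∏ m ∈ Finset.univ.erase l, φ m (x m)) * h

/-- The grid as a finite set. -/
def gridFin (n : ℕ) (k : Fin n → ℕ) : Finset (Fin n → ℕ) :=
  Fintype.piFinset fun l => Finset.range (k l)

theorem mem_gridFin {n : ℕ} {k : Fin n → ℕ} {x : Fin n → ℕ} :
    x ∈ gridFin n k ↔ x ∈ gridSet n k := by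
  simp [gridFin, gridSet]

/-- The weight `∏ₗ (kₗ - 1 choose xₗ)`, for which raising and lowering are adjoint. -/
def gridWeight (n : ℕ) (k : Fin n → ℕ) (x : Fin n → ℕ) : ℝ :=
  ∏ l, ((k l - 1).choose (x l) : ℝ)

/-- The weighted inner product of functions on the grid. -/
def gridInner (n : ℕ) (k : Fin n → ℕ) (f g : (Fin n → ℕ) → ℝ) : ℝ :=
  ∑ x ∈ gridFin n k, gridWeight n k x * (f x * g x)

theorem gridWeight_pos {n : ℕ} {k : Fin n → ℕ} {x : Fin n → ℕ} (hx : x ∈ gridSet n k) :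
    0 < gridWeight n k x :=
  Finset.prod_pos fun l _ => by
    have := hx l
    exact_mod_cast Nat.choose_pos (by omega)

theorem gridWeight_add_single {n : ℕ} {k : Fin n → ℕ} {x : Fin n → ℕ} (hx : x ∈ gridSet n k)
    (l : Fin n) :
    gridWeight n k (x + Pi.single l 1) * (x l + 1) = gridWeight n k x * ((k l : ℝ) - 1 - x l) := by
  refine prod_add_single (fun m t => (((k m - 1).choose t : ℕ) : ℝ)) x l ?_
  have h := Nat.choose_succ_right_eq (k l - 1) (x l)
  have hl := hx l
  have h2 : ((k l - 1 - x l : ℕ) : ℝ) = (k l : ℝ) - 1 - x l := by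
    rw [Nat.cast_sub (by omega), Nat.cast_sub (by omega), Nat.cast_one]
  rw [← h2]
  exact_mod_cast h

theorem gridInner_comm {n : ℕ} (k : Fin n → ℕ) (f g : (Fin n → ℕ) → ℝ) :
    gridInner n k f g = gridInner n k g f :=
  Finset.sum_congr rfl fun _ _ => by ring

theorem gridInner_smul_right {n : ℕ} (k : Fin n → ℕ) (c : ℝ) (f g : (Fin n → ℕ) → ℝ) :
    gridInner n k f (c • g) = c * gridInner n k f g := by
  rw [gridInner, gridInner, Finset.mul_sum]
  exact Finset.sum_congr rfl fun x _ => by simp; ring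

theorem gridInner_smul_left {n : ℕ} (k : Fin n → ℕ) (c : ℝ) (f g : (Fin n → ℕ) → ℝ) :
    gridInner n k (c • f) g = c * gridInner n k f g := by
  rw [gridInner_comm, gridInner_smul_right, gridInner_comm]

theorem gridInner_add_left {n : ℕ} (k : Fin n → ℕ) (f₁ f₂ g : (Fin n → ℕ) → ℝ) :
    gridInner n k (f₁ + f₂) g = gridInner n k f₁ g + gridInner n k f₂ g := by
  rw [gridInner, gridInner, gridInner, ← Finset.sum_add_distrib]
  exact Finset.sum_congr rfl fun x _ => by simp; ring

theorem gridInner_self_nonneg {n : ℕ} (k : Fin n → ℕ) (f : (Fin n → ℕ) → ℝ) :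
    0 ≤ gridInner n k f f :=
  Finset.sum_nonneg fun _ hx =>
    mul_nonneg (gridWeight_pos (mem_gridFin.mp hx)).le (mul_self_nonneg _)

theorem gridInner_self_eq_zero {n : ℕ} {k : Fin n → ℕ} {f : (Fin n → ℕ) → ℝ} :
    gridInner n k f f = 0 ↔ ∀ x ∈ gridSet n k, f x = 0 := by
  rw [gridInner, Finset.sum_eq_zero_iff_of_nonneg fun x hx =>
    mul_nonneg (gridWeight_pos (mem_gridFin.mp hx)).le (mul_self_nonneg _)]
  refine forall_congr' fun x => ?_
  rw [mem_gridFin]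
  refine imp_congr_right fun hx => ?_
  simp [(gridWeight_pos hx).ne']

/-- Raising and lowering are adjoint. -/
theorem gridInner_raiseOp {n : ℕ} (k : Fin n → ℕ) (f g : (Fin n → ℕ) → ℝ) :
    gridInner n k (raiseOp n f) g = gridInner n k f (lowerOp n k g) := by
  simp only [gridInner, raiseOp_apply, lowerOp_apply, Finset.mul_sum, Finset.sum_mul]
  rw [Finset.sum_comm, Finset.sum_comm (s := gridFin n k)]
  refine Finset.sum_congr rfl fun l _ => ?_
  symm
  refine Finset.sum_bij_ne_zero (fun y _ _ => y + Pi.single l 1) ?_ ?_ ?_ ?_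
  · intro y hy h0 
    rw [mem_gridFin] at hy ⊢
    intro m
    rcases eq_or_ne m l with rfl | hm
    · have := hy m
      have h1 : (k m : ℝ) - 1 - y m ≠ 0 := by
        intro h
        simp [h] at h0
      have h2 : y m + 1 ≠ k m := by
        intro h
        apply h1
        rw [← h]
        push_cast
        ring
      simp only [Pi.add_apply, Pi.single_eq_same]
      omega
    · simpa [hm] using hy m
  · intro y _ _ z _ _ h
    exact add_right_cancel h
  · intro x hx h0
    have hl : x l ≠ 0 := by
      intro h
      simp [h] at h0
    have hx' := mem_gridFin.mp hx
    have hy : x - Pi.single l 1 ∈ gridSet n k := fun m => lt_of_le_of_lt (Nat.sub_le _ _) (hx' m)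
    refine ⟨x - Pi.single l 1, mem_gridFin.mpr hy, ?_, sub_single_add_single hl⟩
    have h := gridWeight_add_single hy l
    rw [sub_single_add_single hl] at h ⊢
    have hc : ((x - Pi.single l 1 : Fin n → ℕ) l : ℝ) + 1 = x l := by
      simp [Nat.cast_sub (Nat.one_le_iff_ne_zero.mpr hl)]
    rw [hc] at h
    intro h2
    apply h0
    linear_combination h2 + f (x - Pi.single l 1) * g x * h
  · intro y hy _
    have h := gridWeight_add_single (mem_gridFin.mp hy) l
    rw [add_tsub_cancel_right]
    simp only [Pi.add_apply, Pi.single_eq_same, Nat.cast_add, Nat.cast_one]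
    linear_combination -(f y * g (y + Pi.single l 1)) * h

/-- A function supported on layer `i` of the grid and annihilated by lowering. -/
structure IsHarmonic (n : ℕ) (k : Fin n → ℕ) (i : ℕ) (h : (Fin n → ℕ) → ℝ) : Prop where
  eq_zero_of_notMem : ∀ x, x ∉ layer n k i → h x = 0
  lowerOp_eq_zero : lowerOp n k h = 0

theorem raiseOp_pow_eq_zero {n i : ℕ} {f : (Fin n → ℕ) → ℝ} (hf : ∀ x, wt x ≠ i → f x = 0)
    (s : ℕ) : ∀ x, wt x ≠ i + s → (raiseOp n ^ s) f x = 0 := by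
  induction s with
  | zero => simpa using hf
  | succ s ih =>
    intro x hx
    rw [pow_succ', Module.End.mul_apply, raiseOp_apply]
    refine Finset.sum_eq_zero fun l _ => ?_
    rcases eq_or_ne (x l) 0 with h0 | h0
    · simp [h0]
    · have := wt_sub_single h0
      rw [ih _ (by omega), mul_zero]

namespace IsHarmonic

variable {n : ℕ} {k : Fin n → ℕ} {i : ℕ} {h : (Fin n → ℕ) → ℝ}

theorem raiseOp_pow_eq_zero (hh : IsHarmonic n k i h) (s : ℕ) (x : Fin n → ℕ)
    (hx : wt x ≠ i + s) : (raiseOp n ^ s) h x = 0 :=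
  CoveringSymmetric.raiseOp_pow_eq_zero
    (fun y hy => hh.eq_zero_of_notMem y fun hy' => hy hy'.2) s x hx

theorem lowerOp_raiseOp_pow (hk : ∀ l, 1 ≤ k l) (hh : IsHarmonic n k i h) (s : ℕ) :
    lowerOp n k ((raiseOp n ^ (s + 1)) h) =
      (((s : ℝ) + 1) * ((Ntot n k : ℝ) - 2 * i - s)) • (raiseOp n ^ s) h := by
  induction s with
  | zero =>
    ext x
    rw [pow_one, pow_zero, lowerOp_raiseOp hk, hh.lowerOp_eq_zero]
    rcases eq_or_ne (wt x) i with hx | hx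
    · simp [hx]
    · simp [show h x = 0 from hh.raiseOp_pow_eq_zero 0 x (by simpa using hx)]
  | succ s ih =>
    ext x
    rw [pow_succ', Module.End.mul_apply, lowerOp_raiseOp hk, ih, map_smul,
      ← Module.End.mul_apply (raiseOp n), ← pow_succ']
    simp only [Pi.smul_apply, smul_eq_mul]
    rcases eq_or_ne (wt x) (i + (s + 1)) with hx | hx
    · rw [hx]
      push_cast
      ring
    · rw [hh.raiseOp_pow_eq_zero _ x hx]
      ring

theorem lowerOp_pow_raiseOp_pow (hk : ∀ l, 1 ≤ k l) (hh : IsHarmonic n k i h) (p r : ℕ) :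
    (lowerOp n k ^ r) ((raiseOp n ^ (p + r)) h) =
      (∏ t ∈ Finset.range r, ((p : ℝ) + t + 1) * ((Ntot n k : ℝ) - 2 * i - p - t)) •
        (raiseOp n ^ p) h := by
  induction r with
  | zero => simp
  | succ r ih =>
    rw [pow_succ, Module.End.mul_apply, ← add_assoc, hh.lowerOp_raiseOp_pow hk, map_smul, ih,
      smul_smul, Finset.prod_range_succ]
    congr 1
    push_cast
    ring

theorem lowerOp_pow_raiseOp_pow_of_lt (hk : ∀ l, 1 ≤ k l) (hh : IsHarmonic n k i h) {r s : ℕ}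
    (hrs : s < r) : (lowerOp n k ^ r) ((raiseOp n ^ s) h) = 0 := by
  obtain ⟨t, rfl⟩ := Nat.exists_eq_add_of_lt hrs
  have := hh.lowerOp_pow_raiseOp_pow hk 0 s
  rw [zero_add] at this
  rw [show s + t + 1 = t + 1 + s by ring, pow_add, Module.End.mul_apply, this, map_smul, pow_succ,
    Module.End.mul_apply, pow_zero, Module.End.one_apply, hh.lowerOp_eq_zero, map_zero, smul_zero]

theorem gridInner_raiseOp_pow_succ (hk : ∀ l, 1 ≤ k l) (hh : IsHarmonic n k i h) (s : ℕ) :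
    gridInner n k ((raiseOp n ^ (s + 1)) h) ((raiseOp n ^ (s + 1)) h) =
      (((s : ℝ) + 1) * ((Ntot n k : ℝ) - 2 * i - s)) *
        gridInner n k ((raiseOp n ^ s) h) ((raiseOp n ^ s) h) := by
  conv_lhs => rw [pow_succ', Module.End.mul_apply, gridInner_raiseOp,
    ← Module.End.mul_apply (raiseOp n), ← pow_succ', hh.lowerOp_raiseOp_pow hk,
    gridInner_smul_right]

theorem raiseOp_pow_eq_zero_of_lt (hk : ∀ l, 1 ≤ k l) (hh : IsHarmonic n k i h) {s : ℕ}
    (hs : Ntot n k < 2 * i + s) : ∀ x ∈ gridSet n k, (raiseOp n ^ s) h x = 0 := by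
  rw [← gridInner_self_eq_zero]
  have h1 := hh.gridInner_raiseOp_pow_succ hk s
  have h2 := gridInner_self_nonneg k ((raiseOp n ^ (s + 1)) h)
  have h3 := gridInner_self_nonneg k ((raiseOp n ^ s) h)
  have h4 : (Ntot n k : ℝ) - 2 * i - s < 0 := by
    have : (Ntot n k : ℝ) < 2 * i + s := by exact_mod_cast hs
    linarith
  have h5 : ((s : ℝ) + 1) * ((Ntot n k : ℝ) - 2 * i - s) < 0 :=
    mul_neg_of_pos_of_neg (by positivity) h4
  rw [h1] at h2
  nlinarith

theorem gridInner_raiseOp_pow_pos (hk : ∀ l, 1 ≤ k l) (hh : IsHarmonic n k i h) (h0 : h ≠ 0)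
    {s : ℕ} (hs : 2 * i + s ≤ Ntot n k) :
    0 < gridInner n k ((raiseOp n ^ s) h) ((raiseOp n ^ s) h) := by
  induction s with
  | zero =>
    refine lt_of_le_of_ne (gridInner_self_nonneg _ _) fun h1 => h0 ?_
    rw [pow_zero, Module.End.one_apply] at h1
    ext x
    by_cases hx : x ∈ gridSet n k
    · exact gridInner_self_eq_zero.mp h1.symm x hx
    · exact hh.eq_zero_of_notMem x fun hx' => hx hx'.1
  | succ s ih =>
    rw [hh.gridInner_raiseOp_pow_succ hk]
    have h4 : (2 * i + (s + 1) : ℝ) ≤ Ntot n k := by exact_mod_cast hs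
    exact mul_pos (mul_pos (by positivity) (by linarith)) (ih (by omega))

end IsHarmonic

theorem lowerOp_eq_zero_of_notMem_layer {n : ℕ} {k : Fin n → ℕ} {f : (Fin n → ℕ) → ℝ} {j : ℕ}
    (hf : ∀ x, x ∉ layer n k j → f x = 0) {x : Fin n → ℕ}
    (hx : ¬(x ∈ gridSet n k ∧ wt x + 1 = j)) : lowerOp n k f x = 0 := by
  rw [lowerOp_apply]
  refine Finset.sum_eq_zero fun l _ => ?_
  rw [hf, mul_zero]
  rintro ⟨h1, h2⟩
  refine hx ⟨fun m => lt_of_le_of_lt ?_ (h1 m), by rw [← h2, wt_add_single]⟩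
  simp

/-- The functions `U^s h` with `h` harmonic span the functions on each layer of the grid. -/
theorem eq_zero_of_gridInner_harmonic {n : ℕ} {k : Fin n → ℕ} (j : ℕ) (f : (Fin n → ℕ) → ℝ)
    (hf : ∀ x, x ∉ layer n k j → f x = 0)
    (horth : ∀ i s h, i + s = j → IsHarmonic n k i h → gridInner n k f ((raiseOp n ^ s) h) = 0) :
    f = 0 := by
  have key : lowerOp n k f = 0 → f = 0 := fun h0 => by
    have h1 := horth j 0 f rfl ⟨hf, h0⟩
    rw [pow_zero, Module.End.one_apply, gridInner_self_eq_zero] at h1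
    ext x
    by_cases hx : x ∈ gridSet n k
    · exact h1 x hx
    · exact hf x fun hx' => hx hx'.1
  induction j generalizing f with
  | zero =>
    refine key (funext fun x => lowerOp_eq_zero_of_notMem_layer hf fun hx => ?_)
    exact absurd hx.2 (Nat.succ_ne_zero _)
  | succ j ih =>
    have hD : ∀ x, x ∉ layer n k j → lowerOp n k f x = 0 := fun x hx =>
      lowerOp_eq_zero_of_notMem_layer hf fun hx' => hx ⟨hx'.1, Nat.succ_injective hx'.2⟩
    have hO : ∀ i s h, i + s = j → IsHarmonic n k i h →
        gridInner n k (lowerOp n k f) ((raiseOp n ^ s) h) = 0 := fun i s h his hh => by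
      rw [gridInner_comm, ← gridInner_raiseOp, gridInner_comm, ← Module.End.mul_apply, ← pow_succ']
      exact horth i (s + 1) h (by omega) hh
    refine key (ih _ hD hO fun h0 => ?_)
    have h1 : gridInner n k (lowerOp n k f) (lowerOp n k f) = 0 := by
      simpa using hO j 0 _ rfl ⟨hD, h0⟩
    rw [gridInner_self_eq_zero] at h1
    ext x
    by_cases hx : x ∈ gridSet n k
    · exact h1 x hx
    · exact hD x fun hx' => hx hx'.1

/-- The product of binomial coefficients `∏ₗ (xₗ choose aₗ)`. -/
def binomFun {n : ℕ} (a x : Fin n → ℕ) : ℝ := ∏ l, (((x l).choose (a l) : ℕ) : ℝ)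

theorem binomFun_eq_zero {n : ℕ} {a x : Fin n → ℕ} (h : ¬a ≤ x) : binomFun a x = 0 := by
  rw [Pi.le_def, not_forall] at h
  obtain ⟨l, hl⟩ := h
  exact Finset.prod_eq_zero (Finset.mem_univ l) (by
    rw [Nat.choose_eq_zero_of_lt (not_le.mp hl), Nat.cast_zero])

theorem binomFun_eq_zero_of_wt_lt {n : ℕ} {a x : Fin n → ℕ} (h : wt x < wt a) :
    binomFun a x = 0 :=
  binomFun_eq_zero fun hle => absurd (Finset.sum_le_sum fun l _ => hle l) (not_le.mpr h)

theorem binomFun_of_wt_eq {n : ℕ} {a x : Fin n → ℕ} (h : wt x = wt a) :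
    binomFun a x = (Pi.single a 1 : (Fin n → ℕ) → ℝ) x := by
  rcases eq_or_ne x a with rfl | hne
  · simp [binomFun]
  · rw [Pi.single_eq_of_ne hne]
    refine binomFun_eq_zero fun hle => hne ?_
    have := (Finset.sum_eq_sum_iff_of_le fun l (_ : l ∈ Finset.univ) => hle l).mp h.symm
    exact (funext fun l => this l (Finset.mem_univ l)).symm

theorem binomFun_add_single {n : ℕ} (a x : Fin n → ℕ) (l : Fin n) :
    binomFun (a + Pi.single l 1) x * (a l + 1) = binomFun a x * ((x l : ℝ) - a l) := by
  refine prod_add_single (fun m t => (((x m).choose t : ℕ) : ℝ)) a l ?_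
  rcases le_or_gt (a l) (x l) with hl | hl
  · rw [← Nat.cast_sub hl]
    exact_mod_cast Nat.choose_succ_right_eq (x l) (a l)
  · rw [Nat.choose_eq_zero_of_lt hl, Nat.choose_eq_zero_of_lt (by omega)]
    simp

theorem mul_binomFun_sub_single {n : ℕ} (a x : Fin n → ℕ) (l : Fin n) :
    (x l : ℝ) * binomFun a (x - Pi.single l 1) = ((x l : ℝ) - a l) * binomFun a x := by
  rcases eq_or_ne (x l) 0 with h0 | h0
  · rcases eq_or_ne (a l) 0 with ha | ha
    · simp [h0, ha]
    · rw [binomFun_eq_zero (a := a) (x := x) fun hle => ha (by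
        have := hle l
        simpa [h0] using this)]
      simp [h0]
  · obtain ⟨y, rfl⟩ : ∃ y : Fin n → ℕ, x = y + Pi.single l 1 := ⟨_, (sub_single_add_single h0).symm⟩
    rw [add_tsub_cancel_right]
    have := prod_add_single (fun m t => ((t.choose (a m) : ℕ) : ℝ)) y l
      (a := (y l : ℝ) + 1 - a l) (b := y l + 1) ?_
    · simp only [Pi.add_apply, Pi.single_eq_same, Nat.cast_add, Nat.cast_one, binomFun] at this ⊢
      linear_combination -this
    · rcases le_or_gt (a l) (y l + 1) with hl | hl
      · have := Nat.choose_mul_succ_eq (y l) (a l)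
        rw [show (y l : ℝ) + 1 - a l = ((y l + 1 - a l : ℕ) : ℝ) by rw [Nat.cast_sub hl]; simp]
        exact_mod_cast this.symm
      · rw [Nat.choose_eq_zero_of_lt hl, Nat.choose_eq_zero_of_lt (by omega)]
        simp

/-- Raising a point mass yields binomial functions. -/
theorem raiseOp_pow_single {n : ℕ} (a x : Fin n → ℕ) (r : ℕ) :
    (raiseOp n ^ r) (Pi.single a 1) x =
      if wt x = wt a + r then (r.factorial : ℝ) * binomFun a x else 0 := by
  split_ifs with hx
  · induction r generalizing x with
    | zero => simp [binomFun_of_wt_eq (show wt x = wt a from hx)]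
    | succ r ih =>
      rw [pow_succ', Module.End.mul_apply, raiseOp_apply]
      have : ∀ l, (x l : ℝ) * (raiseOp n ^ r) (Pi.single a 1) (x - Pi.single l 1)
          = r.factorial * binomFun a x * ((x l : ℝ) - a l) := by
        intro l
        rcases eq_or_ne (x l) 0 with h0 | h0
        · have h1 := mul_binomFun_sub_single a x l
          rw [h0] at h1 ⊢
          linear_combination (r.factorial : ℝ) * h1
        · rw [ih _ (by have := wt_sub_single h0; omega)]
          linear_combination (r.factorial : ℝ) * mul_binomFun_sub_single a x l
      simp_rw [this]
      rw [← Finset.mul_sum, Finset.sum_sub_distrib, ← wt_cast, ← wt_cast, hx, Nat.factorial_succ]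
      push_cast
      ring
  · refine raiseOp_pow_eq_zero (fun y hy => Pi.single_eq_of_ne ?_ _) r x hx
    rintro rfl
    exact hy rfl

theorem induction_add_single {n : ℕ} {motive : (Fin n → ℕ) → Prop} (zero : motive 0)
    (add : ∀ a l, motive a → motive (a + Pi.single l 1)) (a : Fin n → ℕ) : motive a := by
  induction hw : wt a generalizing a with
  | zero =>
    have : a = 0 := by
      ext l
      exact (Finset.sum_eq_zero_iff.mp hw) l (Finset.mem_univ l)
    exact this ▸ zero
  | succ w ih =>
    obtain ⟨l, -, hl⟩ : ∃ l ∈ Finset.univ, a l ≠ 0 :=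
      Finset.exists_ne_zero_of_sum_ne_zero (by rw [wt] at hw; omega)
    rw [← sub_single_add_single hl]
    exact add _ l (ih _ (by have := wt_sub_single hl; omega))

theorem exists_eval_eq_binomFun {n : ℕ} (a : Fin n → ℕ) :
    ∃ P : MvPolynomial (Fin n) ℝ, P.totalDegree ≤ wt a ∧
      ∀ x : Fin n → ℕ, eval (toR x) P = binomFun a x := by
  induction a using induction_add_single with
  | zero => exact ⟨1, by simp, fun x => by simp [binomFun]⟩
  | add a l ih =>
    obtain ⟨P, hP, hPx⟩ := ih
    refine ⟨P * (X l - C (a l : ℝ)) * C ((a l + 1 : ℝ)⁻¹), ?_, fun x => ?_⟩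
    · rw [wt_add_single]
      refine (totalDegree_mul _ _).trans ?_
      rw [totalDegree_C, add_zero]
      refine (totalDegree_mul _ _).trans (add_le_add hP ?_)
      exact (totalDegree_sub_C_le _ _).trans (totalDegree_X l).le
    · have := binomFun_add_single a x l
      have h0 : (a l : ℝ) + 1 ≠ 0 := by positivity
      simp only [map_mul, map_sub, eval_X, eval_C, hPx]
      rw [mul_inv_eq_iff_eq_mul₀ h0, this, toR]

/-- The functions spanned by products of binomial coefficients of degree at most `d`. -/
def binomSpan (n d : ℕ) : Submodule ℝ ((Fin n → ℕ) → ℝ) :=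
  Submodule.span ℝ (binomFun '' {a | wt a ≤ d})

theorem binomFun_mem_binomSpan {n d : ℕ} {a : Fin n → ℕ} (ha : wt a ≤ d) :
    binomFun a ∈ binomSpan n d :=
  Submodule.subset_span ⟨a, ha, rfl⟩

theorem binomSpan_mono (n : ℕ) {d e : ℕ} (h : d ≤ e) : binomSpan n d ≤ binomSpan n e :=
  Submodule.span_mono (Set.image_mono fun _ ha => le_trans ha h)

theorem coord_mul_mem_binomSpan {n d : ℕ} {f : (Fin n → ℕ) → ℝ} (hf : f ∈ binomSpan n d)
    (l : Fin n) : (fun x => (x l : ℝ) * f x) ∈ binomSpan n (d + 1) := by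
  induction hf using Submodule.span_induction with
  | mem f hf =>
    obtain ⟨a, ha, rfl⟩ := hf
    have : (fun x : Fin n → ℕ => (x l : ℝ) * binomFun a x)
        = ((a l : ℝ) + 1) • binomFun (a + Pi.single l 1) + (a l : ℝ) • binomFun a := by
      ext x
      simp only [Pi.add_apply, Pi.smul_apply, smul_eq_mul]
      linear_combination -binomFun_add_single a x l
    rw [this]
    have ha' : wt a ≤ d := ha
    exact add_mem
      (Submodule.smul_mem _ _ (binomFun_mem_binomSpan (by rw [wt_add_single]; omega)))
      (Submodule.smul_mem _ _ (binomFun_mem_binomSpan (by omega)))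
  | zero =>
    simp only [Pi.zero_apply, mul_zero]
    exact zero_mem _
  | add f g _ _ hf hg =>
    simp only [Pi.add_apply, mul_add]
    exact add_mem hf hg
  | smul c f _ hf =>
    have : (fun x : Fin n → ℕ => (x l : ℝ) * (c • f) x)
        = c • fun x : Fin n → ℕ => (x l : ℝ) * f x := by
      ext x
      simp only [Pi.smul_apply, smul_eq_mul]
      ring
    rw [this]
    exact Submodule.smul_mem _ _ hf

theorem prod_pow_mem_binomSpan {n : ℕ} (a : Fin n → ℕ) :
    (fun x : Fin n → ℕ => ∏ l, (x l : ℝ) ^ a l) ∈ binomSpan n (wt a) := by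
  induction a using induction_add_single with
  | zero =>
    have : (fun x : Fin n → ℕ => ∏ l, (x l : ℝ) ^ (0 : Fin n → ℕ) l) = binomFun 0 := by
      ext x
      simp [binomFun]
    rw [this]
    exact binomFun_mem_binomSpan le_rfl
  | add a l ih =>
    have : (fun x : Fin n → ℕ => ∏ m, (x m : ℝ) ^ (a + Pi.single l 1 : Fin n → ℕ) m)
        = fun x => (x l : ℝ) * ∏ m, (x m : ℝ) ^ a m := by
      ext x
      have := prod_add_single (fun m t => (x m : ℝ) ^ t) a l (a := 1) (b := x l) (by ring)
      rw [mul_one] at this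
      rw [this, mul_comm]
    rw [this, wt_add_single]
    exact coord_mul_mem_binomSpan ih l

theorem eval_mem_binomSpan {n : ℕ} (P : MvPolynomial (Fin n) ℝ) :
    (fun x : Fin n → ℕ => eval (toR x) P) ∈ binomSpan n P.totalDegree := by
  have : (fun x : Fin n → ℕ => eval (toR x) P)
      = ∑ s ∈ P.support, P.coeff s • fun x : Fin n → ℕ => ∏ l, (x l : ℝ) ^ s l := by
    ext x
    simp [eval_eq', toR]
  rw [this]
  refine sum_mem fun s hs => Submodule.smul_mem _ _ (binomSpan_mono n ?_ (prod_pow_mem_binomSpan s))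
  have := le_totalDegree hs
  rwa [Finsupp.sum_fintype _ _ fun _ => rfl] at this

/-- Iterated adjointness of raising and lowering. -/
theorem gridInner_raiseOp_pow {n : ℕ} (k : Fin n → ℕ) (r : ℕ) (f g : (Fin n → ℕ) → ℝ) :
    gridInner n k ((raiseOp n ^ r) f) g = gridInner n k f ((lowerOp n k ^ r) g) := by
  induction r generalizing g with
  | zero => simp
  | succ r ih =>
    rw [pow_succ', Module.End.mul_apply, gridInner_raiseOp, ih, ← Module.End.mul_apply, ← pow_succ]

theorem gridInner_congr_left {n : ℕ} (k : Fin n → ℕ) {f₁ f₂ g : (Fin n → ℕ) → ℝ}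
    (h : ∀ x ∈ gridSet n k, g x ≠ 0 → f₁ x = f₂ x) :
    gridInner n k f₁ g = gridInner n k f₂ g := by
  refine Finset.sum_congr rfl fun x hx => ?_
  by_cases hg : g x = 0
  · simp [hg]
  · rw [h x (mem_gridFin.mp hx) hg]

theorem gridInner_zero_left {n : ℕ} (k : Fin n → ℕ) (g : (Fin n → ℕ) → ℝ) :
    gridInner n k 0 g = 0 := by
  simp [gridInner]

theorem gridInner_zero_right {n : ℕ} (k : Fin n → ℕ) (g : (Fin n → ℕ) → ℝ) :
    gridInner n k g 0 = 0 := by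
  simp [gridInner]

/-- The scalar by which `D ^ r` maps `U ^ (p + r) h` to `U ^ p h` is a ratio of factorials. -/
theorem prod_lowering_coeff (N i p r : ℕ) (h : 2 * i + (p + r) ≤ N) :
    (∏ t ∈ Finset.range r, ((p : ℝ) + t + 1) * ((N : ℝ) - 2 * i - p - t)) *
      (N - 2 * i - (p + r)).factorial * p.factorial =
      (p + r).factorial * (N - 2 * i - p).factorial := by
  induction r with
  | zero => simp [mul_comm]
  | succ r ih =>
    have ih := ih (by omega)
    rw [Finset.prod_range_succ, ← add_assoc, Nat.factorial_succ]
    obtain ⟨M, hM⟩ : ∃ M, N = 2 * i + (p + r) + (M + 1) :=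
      ⟨N - (2 * i + (p + r)) - 1, by omega⟩
    rw [show N - 2 * i - (p + r) = M + 1 by omega, Nat.factorial_succ] at ih
    rw [show N - 2 * i - (p + r + 1) = M by omega]
    have hN : (N : ℝ) - 2 * i - p - r = M + 1 := by
      rw [hM]
      push_cast
      ring
    rw [hN]
    push_cast at ih ⊢
    linear_combination ((p : ℝ) + r + 1) * ih

theorem IsHarmonic.exists_gridInner_binomFun {n : ℕ} {k : Fin n → ℕ} {i : ℕ}
    {h : (Fin n → ℕ) → ℝ} (hk : ∀ l, 1 ≤ k l) (hh : IsHarmonic n k i h) (a : Fin n → ℕ) :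
    ∃ q ∈ Polynomial.degreeLT ℝ (wt a + 1 - i), ∀ s, 2 * i + s ≤ Ntot n k →
      gridInner n k (binomFun a) ((raiseOp n ^ s) h) * (Ntot n k - 2 * i - s).factorial =
        q.eval (s : ℝ) := by
  have hraise : ∀ r s, i + s = wt a + r →
      (r.factorial : ℝ) * gridInner n k (binomFun a) ((raiseOp n ^ s) h) =
        gridInner n k (Pi.single a 1) ((lowerOp n k ^ r) ((raiseOp n ^ s) h)) := by
    intro r s hrs
    rw [← gridInner_raiseOp_pow, ← gridInner_smul_left]
    refine gridInner_congr_left k fun x _ hx => ?_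
    have hwt : wt x = i + s := by
      by_contra hne
      exact hx (hh.raiseOp_pow_eq_zero s x hne)
    rw [raiseOp_pow_single, if_pos (by omega)]
    rfl
  have hsmall : ∀ s, i + s < wt a →
      gridInner n k (binomFun a) ((raiseOp n ^ s) h) = 0 := by
    intro s hs
    rw [gridInner_congr_left k (f₂ := 0), gridInner_zero_left]
    intro x _ hx
    have hwt : wt x = i + s := by
      by_contra hne
      exact hx (hh.raiseOp_pow_eq_zero s x hne)
    exact binomFun_eq_zero_of_wt_lt (by omega)
  rcases lt_or_ge (wt a) i with hai | hai
  · refine ⟨0, zero_mem _, fun s _ => ?_⟩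
    obtain ⟨r, hr⟩ := Nat.exists_eq_add_of_le (show wt a ≤ i + s by omega)
    have := hraise r s hr
    rw [hh.lowerOp_pow_raiseOp_pow_of_lt hk (by omega), gridInner_zero_right] at this
    rw [(mul_eq_zero.mp this).resolve_left (by exact_mod_cast r.factorial_ne_zero)]
    simp
  · obtain ⟨p, hp⟩ := Nat.exists_eq_add_of_le hai
    set β := gridInner n k (Pi.single a 1) ((raiseOp n ^ p) h) with hβ
    refine ⟨(β * (Ntot n k - 2 * i - p).factorial / p.factorial) • descPochhammer ℝ p,
      Submodule.smul_mem _ _ ?_, fun s hs => ?_⟩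
    · rw [Polynomial.mem_degreeLT, hp, show i + p + 1 - i = p + 1 by omega]
      refine Polynomial.degree_le_natDegree.trans_lt ?_
      rw [descPochhammer_natDegree]
      exact_mod_cast Nat.lt_succ_self p
    · rw [Polynomial.eval_smul, descPochhammer_eval_eq_descFactorial, smul_eq_mul]
      rcases lt_or_ge s p with hsp | hsp
      · rw [hsmall s (by omega), Nat.descFactorial_of_lt hsp]
        simp
      · obtain ⟨r, rfl⟩ := Nat.exists_eq_add_of_le hsp
        have h1 := hraise r (p + r) (by omega)
        rw [hh.lowerOp_pow_raiseOp_pow hk, gridInner_smul_right, ← hβ] at h1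
        have h2 := prod_lowering_coeff (Ntot n k) i p r hs
        have h3 : (r.factorial : ℝ) * (p + r).descFactorial p = (p + r).factorial := by
          have := Nat.factorial_mul_descFactorial (Nat.le_add_right p r)
          rw [Nat.add_sub_cancel_left] at this
          exact_mod_cast this
        have hp0 : (p.factorial : ℝ) ≠ 0 := by exact_mod_cast p.factorial_ne_zero
        have hr0 : (r.factorial : ℝ) ≠ 0 := by exact_mod_cast r.factorial_ne_zero
        rw [div_mul_eq_mul_div, eq_div_iff hp0]
        apply mul_left_cancel₀ hr0
        linear_combination ((Ntot n k - 2 * i - (p + r)).factorial * p.factorial : ℝ) * h1 +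
          β * h2 - β * (Ntot n k - 2 * i - p).factorial * h3

/-- Pairing a polynomial function of degree at most `d` with `U ^ s h`, where `h` is harmonic of
weight `i`, gives, up to a factorial, a polynomial in `s` of degree at most `d - i`. -/
theorem IsHarmonic.exists_gridInner_eq_eval {n : ℕ} {k : Fin n → ℕ} {i d : ℕ}
    {h : (Fin n → ℕ) → ℝ} (hk : ∀ l, 1 ≤ k l) (hh : IsHarmonic n k i h)
    {f : (Fin n → ℕ) → ℝ} (hf : f ∈ binomSpan n d) :
    ∃ q ∈ Polynomial.degreeLT ℝ (d + 1 - i), ∀ s, 2 * i + s ≤ Ntot n k →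
      gridInner n k f ((raiseOp n ^ s) h) * (Ntot n k - 2 * i - s).factorial = q.eval (s : ℝ) := by
  induction hf using Submodule.span_induction with
  | mem f hf =>
    obtain ⟨a, ha, rfl⟩ := hf
    obtain ⟨q, hq, hqs⟩ := hh.exists_gridInner_binomFun hk a
    have ha' : wt a ≤ d := ha
    exact ⟨q, Polynomial.degreeLT_mono (by omega) hq, hqs⟩
  | zero => exact ⟨0, zero_mem _, fun s _ => by simp [gridInner_zero_left]⟩
  | add f g _ _ hf hg =>
    obtain ⟨q, hq, hqs⟩ := hf
    obtain ⟨q', hq', hqs'⟩ := hg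
    refine ⟨q + q', add_mem hq hq', fun s hs => ?_⟩
    rw [gridInner_add_left, add_mul, hqs s hs, hqs' s hs, Polynomial.eval_add]
  | smul c f _ hf =>
    obtain ⟨q, hq, hqs⟩ := hf
    refine ⟨c • q, Submodule.smul_mem _ _ hq, fun s hs => ?_⟩
    rw [gridInner_smul_left, mul_assoc, hqs s hs, Polynomial.eval_smul, smul_eq_mul]

theorem finite_layer (n : ℕ) (k : Fin n → ℕ) (j : ℕ) : (layer n k j).Finite :=
  (gridFin n k).finite_toSet.subset fun _ hx => mem_gridFin.mpr hx.1

/-- Layers growing in size carry nonzero harmonic functions. -/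
theorem exists_isHarmonic_succ {n : ℕ} {k : Fin n → ℕ} {i : ℕ}
    (hlt : (layer n k i).ncard < (layer n k (i + 1)).ncard) :
    ∃ h, IsHarmonic n k (i + 1) h ∧ h ≠ 0 := by
  have := (finite_layer n k i).fintype
  have := (finite_layer n k (i + 1)).fintype
  let φ : (layer n k (i + 1) → ℝ) →ₗ[ℝ] (layer n k i → ℝ) :=
    LinearMap.funLeft ℝ ℝ Subtype.val ∘ₗ lowerOp n k ∘ₗ
      Function.ExtendByZero.linearMap ℝ Subtype.val
  have hφ : LinearMap.ker φ ≠ ⊥ := by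
    refine LinearMap.ker_ne_bot_of_finrank_lt ?_
    rw [Module.finrank_fintype_fun_eq_card, Module.finrank_fintype_fun_eq_card,
      ← Nat.card_eq_fintype_card,
      ← Nat.card_eq_fintype_card, Nat.card_coe_set_eq, Nat.card_coe_set_eq]
    exact hlt
  obtain ⟨g, hg, hg0⟩ := (Submodule.ne_bot_iff _).mp hφ
  set h : (Fin n → ℕ) → ℝ := Function.extend Subtype.val g 0 with hdef
  have hsupp : ∀ x, x ∉ layer n k (i + 1) → h x = 0 := fun x hx =>
    Function.extend_apply' _ _ _ fun ⟨y, hy⟩ => hx (hy ▸ y.2)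
  refine ⟨h, ⟨hsupp, funext fun x => ?_⟩, fun h0 => hg0 (funext fun y => ?_)⟩
  · by_cases hx : x ∈ layer n k i
    · exact congrFun (LinearMap.mem_ker.mp hg) ⟨x, hx⟩
    · exact lowerOp_eq_zero_of_notMem_layer hsupp fun hx' =>
        hx ⟨hx'.1, Nat.succ_injective hx'.2⟩
  · rw [← Subtype.val_injective.extend_apply g 0 y, ← hdef, h0]
    rfl

theorem exists_isHarmonic {n : ℕ} {k : Fin n → ℕ} (hk : ∀ l, 1 ≤ k l) (hSU : SU2 n k) {i : ℕ}
    (hi : 2 * i ≤ Ntot n k) : ∃ h, IsHarmonic n k i h ∧ h ≠ 0 := by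
  cases i with
  | zero =>
    have hsupp : ∀ x, x ∉ layer n k 0 → (Pi.single 0 1 : (Fin n → ℕ) → ℝ) x = 0 := by
      intro x hx
      refine Pi.single_eq_of_ne ?_ _
      rintro rfl
      exact hx ⟨fun l => hk l, by simp [wt]⟩
    refine ⟨Pi.single 0 1, ⟨hsupp, funext fun x => ?_⟩, by simp⟩
    exact lowerOp_eq_zero_of_notMem_layer hsupp fun hx => absurd hx.2 (Nat.succ_ne_zero _)
  | succ i => exact exists_isHarmonic_succ (hSU.1 i (by omega))

/-- A harmonic function extends to a polynomial whose restriction to the layer `i + s` is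
`U ^ s h / s!`. -/
theorem IsHarmonic.exists_polynomial {n : ℕ} {k : Fin n → ℕ} {i : ℕ} {h : (Fin n → ℕ) → ℝ}
    (hh : IsHarmonic n k i h) :
    ∃ P : MvPolynomial (Fin n) ℝ, P.totalDegree ≤ i ∧
      (∀ x, wt x < i → eval (toR x) P = 0) ∧
      ∀ s x, wt x = i + s → (s.factorial : ℝ) * eval (toR x) P = (raiseOp n ^ s) h x := by
  choose B hBdeg hB using exists_eval_eq_binomFun (n := n)
  have hsum : h = ∑ a ∈ gridFin n k with wt a = i, h a • Pi.single a 1 := by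
    ext x
    rw [Finset.sum_apply]
    simp only [Pi.smul_apply, smul_eq_mul, Pi.single_apply, mul_ite, mul_one, mul_zero,
      Finset.sum_ite_eq, Finset.mem_filter, mem_gridFin]
    split_ifs with hx
    · rfl
    · exact hh.eq_zero_of_notMem x fun hx' =>
        hx (Finset.mem_filter.mpr ⟨mem_gridFin.mpr hx'.1, hx'.2⟩)
  refine ⟨∑ a ∈ gridFin n k with wt a = i, h a • B a, ?_, fun x hx => ?_, fun s x hx => ?_⟩
  · refine totalDegree_finsetSum_le fun a ha => (totalDegree_smul_le _ _).trans ?_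
    exact (hBdeg a).trans (Finset.mem_filter.mp ha).2.le
  · rw [map_sum]
    refine Finset.sum_eq_zero fun a ha => ?_
    rw [smul_eval, hB, binomFun_eq_zero_of_wt_lt (by rwa [(Finset.mem_filter.mp ha).2]), mul_zero]
  · conv_rhs => rw [hsum]
    rw [map_sum, map_sum, Finset.sum_apply, Finset.mul_sum]
    refine Finset.sum_congr rfl fun a ha => ?_
    rw [map_smul (raiseOp n ^ s), Pi.smul_apply, raiseOp_pow_single,
      if_pos (by rw [hx, (Finset.mem_filter.mp ha).2]), smul_eval, hB, smul_eq_mul]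
    ring

theorem notMem_T {N i j : ℕ} (hj : j ≤ N) : j ∉ T N i ↔ i ≤ j ∧ j ≤ N - i := by
  simp only [T, Finset.mem_union, Finset.mem_range, Finset.mem_Icc]
  omega

theorem exists_cover_of_admitting {n : ℕ} {k : Fin n → ℕ} (hk : ∀ l, 1 ≤ k l) (hSU : SU2 n k)
    {E : Finset ℕ} (hE : E ⊆ Finset.range (Ntot n k + 1)) {d i : ℕ} (hid : i ≤ d)
    (hi : i ≤ Ntot n k) (hadm : Admitting (Ntot n k) d i E) :
    ∃ P : MvPolynomial (Fin n) ℝ, P.totalDegree ≤ d ∧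
      wdSet n k E ⊆ ZG n k P ∧ ZG n k P ≠ gridSet n k := by
  obtain ⟨hne, hcard⟩ := hadm
  obtain ⟨j, hjN, hjE, hjT⟩ : ∃ j ≤ Ntot n k, j ∉ E ∧ j ∉ T (Ntot n k) i := by
    by_contra! hcon
    refine hne (Finset.Subset.antisymm (Finset.union_subset hE fun j hj => ?_) fun j hj => ?_)
    · simp only [T, Finset.mem_union, Finset.mem_range, Finset.mem_Icc] at hj ⊢
      omega
    · rw [Finset.mem_union, or_iff_not_imp_left]
      exact hcon j (Nat.lt_succ_iff.mp (Finset.mem_range.mp hj))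
  obtain ⟨hij, hjNi⟩ := (notMem_T hjN).mp hjT
  obtain ⟨h, hh, h0⟩ := exists_isHarmonic hk hSU (i := i) (by omega)
  obtain ⟨P, hPdeg, hPlow, hP⟩ := hh.exists_polynomial
  set Q : MvPolynomial (Fin n) ℝ :=
    ∏ t ∈ E \ T (Ntot n k) i, ((∑ l, X l) - C (t : ℝ)) with hQ
  have hQeval : ∀ x : Fin n → ℕ,
      eval (toR x) Q = ∏ t ∈ E \ T (Ntot n k) i, ((wt x : ℝ) - t) := fun x => by
    simp [hQ, map_prod, toR, wt]
  have hQdeg : Q.totalDegree ≤ (E \ T (Ntot n k) i).card := by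
    refine (totalDegree_finsetProd _ _).trans ?_
    rw [Finset.card_eq_sum_ones]
    refine Finset.sum_le_sum fun t _ => (totalDegree_sub_C_le _ _).trans ?_
    exact totalDegree_finsetSum_le fun l _ => (totalDegree_X l).le
  refine ⟨P * Q, (totalDegree_mul _ _).trans (by omega), fun x hx => ⟨hx.1, ?_⟩, fun hZ => ?_⟩
  · rw [map_mul]
    by_cases hT : wt x ∈ T (Ntot n k) i
    · rcases lt_or_ge (wt x) i with hlt | hge
      · rw [hPlow x hlt, zero_mul]
      · obtain ⟨s, hs⟩ := Nat.exists_eq_add_of_le hge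
        have hlarge : Ntot n k < 2 * i + s := by
          simp only [T, Finset.mem_union, Finset.mem_range, Finset.mem_Icc] at hT
          omega
        have := hP s x hs
        rw [hh.raiseOp_pow_eq_zero_of_lt hk hlarge x hx.1] at this
        rw [(mul_eq_zero.mp this).resolve_left (by exact_mod_cast s.factorial_ne_zero), zero_mul]
    · rw [hQeval, Finset.prod_eq_zero (Finset.mem_sdiff.mpr ⟨hx.2, hT⟩) (sub_self _), mul_zero]
  · obtain ⟨s, rfl⟩ := Nat.exists_eq_add_of_le hij
    refine (hh.gridInner_raiseOp_pow_pos hk h0 (s := s) (by omega)).ne'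
      (gridInner_self_eq_zero.mpr fun x hx => ?_)
    by_cases hw : wt x = i + s
    · have hx0 : eval (toR x) (P * Q) = 0 := (hZ.symm ▸ hx : x ∈ ZG n k (P * Q)).2
      rw [map_mul, hQeval] at hx0
      rw [← hP s x hw, (mul_eq_zero.mp hx0).resolve_right, mul_zero]
      refine Finset.prod_ne_zero_iff.mpr fun t ht => sub_ne_zero.mpr fun heq => hjE ?_
      have : wt x = t := by exact_mod_cast heq
      rw [← hw, this]
      exact (Finset.mem_sdiff.mp ht).1
    · exact hh.raiseOp_pow_eq_zero s x hw

theorem eval_eq_zero_of_not_dAdmitting {n : ℕ} {k : Fin n → ℕ} (hk : ∀ l, 1 ≤ k l)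
    {E : Finset ℕ} (hE : E ⊆ Finset.range (Ntot n k + 1)) (P : MvPolynomial (Fin n) ℝ)
    (hP : wdSet n k E ⊆ ZG n k P) (hadm : ¬DAdmitting (Ntot n k) P.totalDegree E) :
    ∀ x ∈ gridSet n k, eval (toR x) P = 0 := by
  classical
  intro y hy
  have hzero : ∀ i s h, IsHarmonic n k i h → i + s ∈ E →
      gridInner n k (fun x => eval (toR x) P) ((raiseOp n ^ s) h) = 0 := by
    intro i s h hh hE'
    rw [gridInner_congr_left k (f₂ := 0), gridInner_zero_left]
    intro x hx hx0
    refine (hP ⟨hx, ?_⟩).2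
    rw [show wt x = i + s from by_contra fun hne => hx0 (hh.raiseOp_pow_eq_zero s x hne)]
    exact hE'
  let f : (Fin n → ℕ) → ℝ := fun x => if x ∈ layer n k (wt y) then eval (toR x) P else 0
  suffices hf : f = 0 by
    have hfy := congrFun hf y
    rwa [show f y = eval (toR y) P from if_pos ⟨hy, rfl⟩] at hfy
  refine eq_zero_of_gridInner_harmonic (wt y) f (fun x hx => if_neg hx) fun i s h his hh => ?_
  rcases lt_or_ge (Ntot n k) (2 * i + s) with hs | hs
  · rw [gridInner_congr_left k (f₂ := 0), gridInner_zero_left]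
    exact fun x hx hx0 => absurd (hh.raiseOp_pow_eq_zero_of_lt hk hs x hx) hx0
  have hlayer : ∀ x ∈ gridSet n k, (raiseOp n ^ s) h x ≠ 0 → f x = eval (toR x) P :=
    fun x hx hx0 => if_pos
      ⟨hx, his ▸ by_contra fun hne => hx0 (hh.raiseOp_pow_eq_zero s x hne)⟩
  rw [gridInner_congr_left k hlayer]
  by_cases hjE : i + s ∈ E
  · exact hzero i s h hh hjE
  obtain ⟨q, hq, hqs⟩ := hh.exists_gridInner_eq_eval hk (eval_mem_binomSpan P)
  have hsub : ∀ t ∈ E \ T (Ntot n k) i, i ≤ t ∧ t ≤ Ntot n k - i := fun t ht => by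
    obtain ⟨htE, htT⟩ := Finset.mem_sdiff.mp ht
    exact (notMem_T (Nat.lt_succ_iff.mp (Finset.mem_range.mp (hE htE)))).mp htT
  have hcard : P.totalDegree + 1 - i ≤ (E \ T (Ntot n k) i).card := by
    by_contra! hlt
    refine hadm ⟨i, by omega, fun heq => ?_, by omega⟩
    have hmem : i + s ∈ E ∪ T (Ntot n k) i := heq ▸ Finset.mem_range.mpr (by omega)
    exact (notMem_T (by omega)).mpr (by omega) ((Finset.mem_union.mp hmem).resolve_left hjE)
  have hq0 : q = 0 := by
    refine Polynomial.eq_zero_of_degree_lt_of_eval_index_eq_zero (v := fun t : ℕ => ((t - i : ℕ) : ℝ))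
      (E \ T (Ntot n k) i) ?_ ((Polynomial.mem_degreeLT.mp hq).trans_le (by exact_mod_cast hcard))
      fun t ht => ?_
    · intro t ht t' ht' heq
      have h1 := hsub t ht
      have h2 := hsub t' ht'
      have h3 : t - i = t' - i := Nat.cast_injective heq
      omega
    · have h1 := hsub t ht
      rw [← hqs (t - i) (by omega), hzero i (t - i) h hh, zero_mul]
      rw [Nat.add_sub_cancel' h1.1]
      exact (Finset.mem_sdiff.mp ht).1
  have := hqs s hs
  rw [hq0, Polynomial.eval_zero] at this
  exact (mul_eq_zero.mp this).resolve_right (by exact_mod_cast Nat.factorial_ne_zero _)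

/-- for an SU² grid, `PC_G(E) = min{d ∈ [0,N] : E is d-admitting}`. -/
theorem stmt1 (n : ℕ) (hn : 1 ≤ n) (k : Fin n → ℕ) (hk : ∀ i, 2 ≤ k i) (hSU : SU2 n k)
    (E : Finset ℕ) (hE : E ⊂ Finset.range (Ntot n k + 1)) :
    PC n k E = sInf {d | d ≤ Ntot n k ∧ DAdmitting (Ntot n k) d E} := by
  have hk' : ∀ l, 1 ≤ k l := fun l => one_le_two.trans (hk l)
  have hne : {d | d ≤ Ntot n k ∧ DAdmitting (Ntot n k) d E}.Nonempty := by
    have hlt := Finset.card_lt_card hE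
    rw [Finset.card_range] at hlt
    refine ⟨E.card, by omega, 0, Nat.zero_le _, ?_, ?_⟩
    · simpa [T] using hE.ne
    · exact Finset.card_le_card Finset.sdiff_subset
  obtain ⟨hdN, i, hid, hadm⟩ := Nat.sInf_mem hne
  obtain ⟨P, hPdeg, hP⟩ := exists_cover_of_admitting hk' hSU hE.subset hid (hid.trans hdN) hadm
  have hPC : PC n k E ≤ P.totalDegree := by
    rw [PC]
    exact Nat.sInf_le ⟨P, rfl, hP⟩
  refine le_antisymm (hPC.trans hPdeg) ?_
  rw [PC]
  refine le_csInf ⟨_, P, rfl, hP⟩ ?_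
  rintro _ ⟨Q, rfl, hQ, hQne⟩
  by_contra! hlt
  refine hQne (Set.Subset.antisymm (fun x hx => hx.1) fun x hx => ⟨hx, ?_⟩)
  refine eval_eq_zero_of_not_dAdmitting hk' hE.subset Q hQ (fun hadm' => ?_) x hx
  exact hlt.not_ge (Nat.sInf_le ⟨hlt.le.trans hdN, hadm'⟩)

end CoveringSymmetric
end
end

section
/- Let G be an SU² grid and let E ⊊ {0,…,N}. Then PPC_G(E) = |E| - max{i ∈ {0,…,⌊N/2⌋} : T_{N,i} ⊆ E}. -/
open MvPolynomial

noncomputable section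

namespace CoveringSymmetric

/-- The set functions on a finite type spanned by the indicators of `B ⊆ S` with `|B| ≤ d`:
the functions on the Boolean cube of degree at most `d`. -/
def cubeDeg (ι : Type*) [DecidableEq ι] (d : ℕ) : Submodule ℝ (Finset ι → ℝ) :=
  Submodule.span ℝ
    {f | ∃ B : Finset ι, B.card ≤ d ∧ f = fun S => if B ⊆ S then (1 : ℝ) else 0}

section Cube

variable {ι : Type*} [DecidableEq ι]

theorem indicator_mem_cubeDeg {d : ℕ} {B : Finset ι} (hB : B.card ≤ d) :
    (fun S : Finset ι => if B ⊆ S then (1 : ℝ) else 0) ∈ cubeDeg ι d :=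
  Submodule.subset_span ⟨B, hB, rfl⟩

theorem cubeDeg_mono {d e : ℕ} (h : d ≤ e) : cubeDeg ι d ≤ cubeDeg ι e :=
  Submodule.span_mono fun _ ⟨B, hB, hf⟩ => ⟨B, hB.trans h, hf⟩

theorem mul_mem_cubeDeg {d e : ℕ} {f g : Finset ι → ℝ} (hf : f ∈ cubeDeg ι d)
    (hg : g ∈ cubeDeg ι e) : f * g ∈ cubeDeg ι (d + e) := by
  have h : f * g ∈ cubeDeg ι d * cubeDeg ι e := Submodule.mul_mem_mul hf hg
  rw [cubeDeg, cubeDeg, Submodule.span_mul_span] at h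
  refine Submodule.span_le.2 ?_ h
  rintro _ ⟨_, ⟨B, hB, rfl⟩, _, ⟨B', hB', rfl⟩, rfl⟩
  have : (fun S : Finset ι => if B ⊆ S then (1 : ℝ) else 0) *
      (fun S : Finset ι => if B' ⊆ S then (1 : ℝ) else 0) =
      fun S => if B ∪ B' ⊆ S then (1 : ℝ) else 0 := by
    funext S
    simp only [Pi.mul_apply, Finset.union_subset_iff]
    split_ifs <;> simp_all
  change _ * _ ∈ _
  rw [this]
  exact indicator_mem_cubeDeg ((Finset.card_union_le _ _).trans (add_le_add hB hB'))

theorem const_mem_cubeDeg (d : ℕ) (c : ℝ) : (fun _ : Finset ι => c) ∈ cubeDeg ι d := by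
  have h := (cubeDeg ι d).smul_mem c (indicator_mem_cubeDeg (B := ∅) (Nat.zero_le d))
  convert h using 1
  funext S
  simp

theorem pow_mem_cubeDeg {f : Finset ι → ℝ} (hf : f ∈ cubeDeg ι 1) (m : ℕ) :
    f ^ m ∈ cubeDeg ι m := by
  induction m with
  | zero => rw [pow_zero]; exact const_mem_cubeDeg 0 1
  | succ m ih => rw [pow_succ]; exact mul_mem_cubeDeg ih hf

theorem prod_mem_cubeDeg {σ : Type*} (s : Finset σ) (f : σ → Finset ι → ℝ) (m : σ → ℕ)
    (hf : ∀ i ∈ s, f i ∈ cubeDeg ι (m i)) : ∏ i ∈ s, f i ∈ cubeDeg ι (∑ i ∈ s, m i) := by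
  classical
  induction s using Finset.induction_on with
  | empty => rw [Finset.prod_empty, Finset.sum_empty]; exact const_mem_cubeDeg 0 1
  | insert i s hi ih =>
    rw [Finset.prod_insert hi, Finset.sum_insert hi]
    exact mul_mem_cubeDeg (hf i (by simp)) (ih fun j hj => hf j (by simp [hj]))

theorem eval_mem_cubeDeg {σ : Type*} (y : Finset ι → σ → ℝ)
    (hy : ∀ i, (fun S => y S i) ∈ cubeDeg ι 1) (P : MvPolynomial σ ℝ) :
    (fun S => eval (y S) P) ∈ cubeDeg ι P.totalDegree := by
  have : (fun S => eval (y S) P) =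
      ∑ m ∈ P.support, P.coeff m • ∏ i ∈ m.support, (fun S => y S i) ^ m i := by
    funext S
    rw [eval_eq]
    simp
  rw [this]
  refine Submodule.sum_mem _ fun m hm => Submodule.smul_mem _ _ ?_
  exact cubeDeg_mono (le_totalDegree hm)
    (prod_mem_cubeDeg _ _ _ fun i _ => pow_mem_cubeDeg (hy i) _)

/-- The averages of a degree-`d` function over the slices of the Boolean cube are given by a
univariate polynomial of degree at most `d`. -/
theorem exists_polynomial_sum_slice [Fintype ι] {d : ℕ} {f : Finset ι → ℝ}
    (hf : f ∈ cubeDeg ι d) :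
    ∃ q : Polynomial ℝ, q.natDegree ≤ d ∧ ∀ t ≤ Fintype.card ι,
      ∑ S ∈ Finset.powersetCard t Finset.univ, f S =
        ((Fintype.card ι).choose t : ℝ) * q.eval (t : ℝ) := by
  induction hf using Submodule.span_induction with
  | mem f hf =>
    obtain ⟨B, hB, rfl⟩ := hf
    have hBι : B.card ≤ Fintype.card ι := Finset.card_le_univ B
    refine ⟨Polynomial.C (((Fintype.card ι).descFactorial B.card : ℝ)⁻¹) *
      descPochhammer ℝ B.card, ?_, ?_⟩
    · refine (Polynomial.natDegree_C_mul_le _ _).trans ?_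
      rwa [descPochhammer_natDegree]
    · intro t ht
      rw [Polynomial.eval_mul, Polynomial.eval_C, descPochhammer_eval_eq_descFactorial,
        Finset.sum_boole]
      have h0 : ((Fintype.card ι).descFactorial B.card : ℝ) ≠ 0 := by
        rw [Nat.cast_ne_zero, Ne, Nat.descFactorial_eq_zero_iff_lt]
        omega
      by_cases hBt : B.card ≤ t
      · rw [Finset.card_filter_powersetCard_subset _ _ _ (Finset.subset_univ _) hBt,
          Finset.card_univ]
        field_simp
        have := Nat.choose_mul (n := Fintype.card ι) hBt
        rw [Nat.descFactorial_eq_factorial_mul_choose, Nat.descFactorial_eq_factorial_mul_choose]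
        push_cast
        have h' : ((Fintype.card ι).choose t : ℝ) * t.choose B.card =
          (Fintype.card ι).choose B.card * (Fintype.card ι - B.card).choose (t - B.card) := by
          exact_mod_cast this
        linear_combination -(B.card.factorial : ℝ) * h'
      · rw [Nat.descFactorial_eq_zero_iff_lt.2 (not_le.1 hBt), Finset.filter_false_of_mem]
        · simp
        · intro S hS hBS
          rw [Finset.mem_powersetCard] at hS
          exact hBt (hS.2 ▸ Finset.card_le_card hBS)
  | zero => exact ⟨0, by simp, by simp⟩
  | add f g _ _ hf hg =>
    obtain ⟨p, hp, hp'⟩ := hf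
    obtain ⟨q, hq, hq'⟩ := hg
    refine ⟨p + q, Polynomial.natDegree_add_le_of_degree_le hp hq, fun t ht => ?_⟩
    simp only [Pi.add_apply, Finset.sum_add_distrib, hp' t ht, hq' t ht, Polynomial.eval_add]
    ring
  | smul c f _ hf =>
    obtain ⟨p, hp, hp'⟩ := hf
    refine ⟨c • p, (Polynomial.natDegree_smul_le _ _).trans hp, fun t ht => ?_⟩
    simp only [Pi.smul_apply, smul_eq_mul, ← Finset.mul_sum, hp' t ht, Polynomial.eval_smul]
    ring

theorem eq_zero_of_vanish_on_slices [Fintype ι] {d : ℕ} {f : Finset ι → ℝ}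
    (hf : f ∈ cubeDeg ι d) (A : Finset ℕ) (hA : d < A.card) (hA' : ∀ t ∈ A, t ≤ Fintype.card ι)
    (h : ∀ S : Finset ι, S.card ∈ A → f S = 0) : f Finset.univ = 0 := by
  obtain ⟨q, hq, hq'⟩ := exists_polynomial_sum_slice hf
  have hroot : ∀ t ∈ A.map (Nat.castEmbedding (R := ℝ)), q.eval t = 0 := by
    intro t ht
    obtain ⟨t, htA, rfl⟩ := Finset.mem_map.1 ht
    have h1 := hq' t (hA' t htA)
    rw [Finset.sum_eq_zero fun S hS => h S ((Finset.mem_powersetCard.1 hS).2 ▸ htA)] at h1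
    refine (mul_eq_zero.1 h1.symm).resolve_left ?_
    exact_mod_cast (Nat.choose_pos (hA' t htA)).ne'
  have hq0 : q = 0 := by
    refine Polynomial.eq_zero_of_natDegree_lt_card_of_eval_eq_zero' q _ hroot ?_
    rw [Finset.card_map]
    omega
  have h1 := hq' _ le_rfl
  rw [← Finset.card_univ, Finset.powersetCard_self, Finset.sum_singleton, hq0] at h1
  simpa using h1

end Cube

/-- Number of elements of `S` in the `i`-th block. -/
def blockCount {n : ℕ} {a : Fin n → ℕ} (S : Finset (Σ i : Fin n, Fin (a i))) (i : Fin n) : ℕ :=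
  (S.filter fun e => e.1 = i).card

section BlockCount

variable {n : ℕ} {a : Fin n → ℕ}

theorem blockCount_univ : blockCount (Finset.univ : Finset (Σ i : Fin n, Fin (a i))) = a := by
  funext i
  have : (Finset.univ.filter fun e : Σ i : Fin n, Fin (a i) => e.1 = i) =
      Finset.univ.map (Function.Embedding.sigmaMk i) := by
    ext ⟨i', x⟩
    simp only [Finset.mem_filter, Finset.mem_univ, true_and, Finset.mem_map,
      Function.Embedding.sigmaMk_apply]
    constructor
    · rintro rfl
      exact ⟨x, rfl⟩
    · rintro ⟨_, h⟩
      exact (congrArg Sigma.fst h).symm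
  rw [blockCount, this]
  simp

theorem blockCount_le (S : Finset (Σ i : Fin n, Fin (a i))) (i : Fin n) : blockCount S i ≤ a i := by
  calc blockCount S i ≤ blockCount Finset.univ i :=
        Finset.card_le_card (Finset.filter_subset_filter _ (Finset.subset_univ _))
    _ = a i := by rw [blockCount_univ]

theorem sum_blockCount (S : Finset (Σ i : Fin n, Fin (a i))) : ∑ i, blockCount S i = S.card :=
  (Finset.card_eq_sum_card_fiberwise fun _ _ => Finset.mem_coe.2 (Finset.mem_univ _)).symm

theorem blockCount_mem_cubeDeg (i : Fin n) :
    (fun S : Finset (Σ i : Fin n, Fin (a i)) => (blockCount S i : ℝ)) ∈ cubeDeg _ 1 := by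
  have : (fun S : Finset (Σ i : Fin n, Fin (a i)) => (blockCount S i : ℝ)) =
      ∑ e ∈ Finset.univ.filter (fun e => e.1 = i),
        fun S => if {e} ⊆ S then (1 : ℝ) else 0 := by
    funext S
    rw [Finset.sum_apply, Finset.sum_boole, blockCount, Finset.filter_filter]
    congr 2
    ext e
    simp [and_comm]
  rw [this]
  exact Submodule.sum_mem _ fun e _ => indicator_mem_cubeDeg (by simp)

end BlockCount

section Grid

variable {n : ℕ} {k : Fin n → ℕ}

theorem wt_le_Ntot {x : Fin n → ℕ} (hx : x ∈ gridSet n k) : wt x ≤ Ntot n k :=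
  Finset.sum_le_sum fun i _ => Nat.le_sub_one_of_lt (hx i)

/-- The antipodal map `x ↦ k - 1 - x` of the grid. -/
def reflect (k : Fin n → ℕ) (x : Fin n → ℕ) : Fin n → ℕ := fun i => k i - 1 - x i

theorem wt_reflect_add {x : Fin n → ℕ} (hx : ∀ i, x i ≤ k i - 1) :
    wt (reflect k x) + wt x = Ntot n k := by
  rw [wt, wt, Ntot, ← Finset.sum_add_distrib]
  exact Finset.sum_congr rfl fun i _ => Nat.sub_add_cancel (hx i)

theorem reflect_mem_gridSet (hk : ∀ i, 2 ≤ k i) (x : Fin n → ℕ) : reflect k x ∈ gridSet n k :=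
  fun i => by have := hk i; simp only [reflect]; omega

theorem reflect_reflect {x : Fin n → ℕ} (hx : x ∈ gridSet n k) : reflect k (reflect k x) = x := by
  funext i
  have := hx i
  simp only [reflect]
  omega

theorem layer_subset_ZG_of_le {d : ℕ} {P : MvPolynomial (Fin n) ℝ} (hP : P.totalDegree ≤ d)
    {A : Finset ℕ} (hA : d < A.card) (hAP : ∀ t ∈ A, layer n k t ⊆ ZG n k P) {j : ℕ}
    (hj : ∀ t ∈ A, t ≤ j) : layer n k j ⊆ ZG n k P := by
  rintro a ⟨ha, rfl⟩
  refine ⟨ha, ?_⟩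
  have hmem := cubeDeg_mono hP (eval_mem_cubeDeg
    (fun S : Finset (Σ i : Fin n, Fin (a i)) => toR (blockCount S)) blockCount_mem_cubeDeg P)
  have := eq_zero_of_vanish_on_slices hmem A hA (fun t ht => by simpa [wt] using hj t ht) ?_
  · simpa only [blockCount_univ] using this
  · intro S hS
    exact (hAP _ hS ⟨fun i => (blockCount_le S i).trans_lt (ha i), sum_blockCount S⟩).2

theorem layer_subset_ZG_of_ge (hk : ∀ i, 2 ≤ k i) {d : ℕ} {P : MvPolynomial (Fin n) ℝ}
    (hP : P.totalDegree ≤ d) {A : Finset ℕ} (hA : d < A.card)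
    (hAP : ∀ t ∈ A, layer n k t ⊆ ZG n k P) (hAN : ∀ t ∈ A, t ≤ Ntot n k) {j : ℕ}
    (hj : ∀ t ∈ A, j ≤ t) : layer n k j ⊆ ZG n k P := by
  rintro a ⟨ha, rfl⟩
  refine ⟨ha, ?_⟩
  have hwt := wt_reflect_add fun i => Nat.le_sub_one_of_lt (ha i)
  have hle : ∀ (S : Finset (Σ i : Fin n, Fin (reflect k a i))) i, blockCount S i ≤ k i - 1 :=
    fun S i => (blockCount_le S i).trans (Nat.sub_le _ _)
  have hmem := cubeDeg_mono hP (eval_mem_cubeDeg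
    (fun S : Finset (Σ i : Fin n, Fin (reflect k a i)) => toR (reflect k (blockCount S)))
    (fun i => by
      convert Submodule.sub_mem _ (const_mem_cubeDeg 1 ((k i - 1 : ℕ) : ℝ))
        (blockCount_mem_cubeDeg i) using 1
      funext S
      exact Nat.cast_sub (hle S i)) P)
  have := eq_zero_of_vanish_on_slices hmem (A.image fun t => Ntot n k - t) ?_ ?_ ?_
  · simpa only [blockCount_univ, reflect_reflect ha] using this
  · rwa [Finset.card_image_of_injOn]
    intro s hs t ht hst
    have := hAN s hs
    have := hAN t ht
    simp only at hst
    omega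
  · intro t ht
    obtain ⟨s, hs, rfl⟩ := Finset.mem_image.1 ht
    have := hj s hs
    have hcard : Fintype.card (Σ i : Fin n, Fin (reflect k a i)) = wt (reflect k a) := by
      simp [wt]
    omega
  · intro S hS
    obtain ⟨s, hs, hsS⟩ := Finset.mem_image.1 hS
    refine (hAP s hs ⟨reflect_mem_gridSet hk _, ?_⟩).2
    have h1 := wt_reflect_add (hle S)
    have h2 : wt (blockCount S) = S.card := sum_blockCount S
    have := hAN s hs
    omega

/-- The layer of weight `j` as a finset. -/
def layerFinset (n : ℕ) (k : Fin n → ℕ) (j : ℕ) : Finset (Fin n → ℕ) :=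
  (Fintype.piFinset fun i => Finset.range (k i)).filter fun x => wt x = j

theorem mem_layerFinset {j : ℕ} {x : Fin n → ℕ} :
    x ∈ layerFinset n k j ↔ x ∈ layer n k j := by
  simp [layerFinset, layer, gridSet]

theorem ncard_layer (j : ℕ) : (layer n k j).ncard = (layerFinset n k j).card := by
  rw [← Set.ncard_coe_finset]
  congr 1
  ext x
  exact mem_layerFinset.symm

theorem card_layerFinset_sub (hk : ∀ i, 2 ≤ k i) {j : ℕ} (hj : j ≤ Ntot n k) :
    (layerFinset n k (Ntot n k - j)).card = (layerFinset n k j).card := by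
  refine Finset.card_nbij' (reflect k) (reflect k) ?_ ?_ ?_ ?_
  · intro x hx
    obtain ⟨hx, hw⟩ := mem_layerFinset.1 hx
    have := wt_reflect_add fun i => Nat.le_sub_one_of_lt (hx i)
    exact mem_layerFinset.2 ⟨reflect_mem_gridSet hk x, by omega⟩
  · intro x hx
    obtain ⟨hx, hw⟩ := mem_layerFinset.1 hx
    have := wt_reflect_add fun i => Nat.le_sub_one_of_lt (hx i)
    exact mem_layerFinset.2 ⟨reflect_mem_gridSet hk x, by omega⟩
  · exact fun x hx => reflect_reflect (mem_layerFinset.1 hx).1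
  · exact fun x hx => reflect_reflect (mem_layerFinset.1 hx).1

/-- Dimension count: monomials with exponents in `A` (inside the grid) give a polynomial that is
nonzero on the grid and vanishes on any smaller set `B`. -/
theorem exists_polynomial_vanish (A B : Finset (Fin n → ℕ)) (hA : ∀ a ∈ A, a ∈ gridSet n k)
    (hAB : B.card < A.card) (d : ℕ) (hd : ∀ a ∈ A, wt a ≤ d) :
    ∃ P : MvPolynomial (Fin n) ℝ, P.totalDegree ≤ d ∧ (∀ b ∈ B, eval (toR b) P = 0) ∧
      ∃ x ∈ gridSet n k, eval (toR x) P ≠ 0 := by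
  classical
  let F : (A → ℝ) →ₗ[ℝ] MvPolynomial (Fin n) ℝ :=
    ∑ a : A, (monomial (Finsupp.equivFunOnFinite.symm (a : Fin n → ℕ))).comp
      (LinearMap.proj (R := ℝ) (φ := fun _ : A => ℝ) a)
  have hF : ∀ c, F c = ∑ a : A, monomial (Finsupp.equivFunOnFinite.symm (a : Fin n → ℕ)) (c a) :=
    fun c => by simp [F]
  let L : (A → ℝ) →ₗ[ℝ] (B → ℝ) :=
    LinearMap.pi fun b => (aeval (R := ℝ) (toR (b : Fin n → ℕ))).toLinearMap.comp F
  have hker : LinearMap.ker L ≠ ⊥ := L.ker_ne_bot_of_finrank_lt (by simpa using hAB)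
  obtain ⟨c, hc, hc0⟩ := Submodule.exists_mem_ne_zero_of_ne_bot hker
  have hcoeff : ∀ m ∈ (F c).support, ∃ a ∈ A, ∀ i, m i = a i := by
    intro m hm
    rw [hF] at hm
    obtain ⟨a, -, ha⟩ := Finset.mem_biUnion.1 (support_sum hm)
    have := Finset.mem_singleton.1 (support_monomial_subset ha)
    exact ⟨a, a.2, fun i => by rw [this]; rfl⟩
  have hF0 : F c ≠ 0 := by
    intro h0
    apply hc0
    funext a
    have h1 := congrArg (coeff (Finsupp.equivFunOnFinite.symm (a : Fin n → ℕ))) h0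
    rw [hF, coeff_sum, Finset.sum_eq_single a] at h1
    · simpa using h1
    · intro b _ hb
      rw [coeff_monomial, if_neg]
      exact fun h => hb (Subtype.ext (Finsupp.equivFunOnFinite.symm.injective h))
    · simp
  refine ⟨F c, ?_, ?_, ?_⟩
  · refine Finset.sup_le fun m hm => ?_
    obtain ⟨a, ha, hma⟩ := hcoeff m hm
    rw [Finsupp.sum_fintype _ _ (by simp)]
    simpa [wt, hma] using hd a ha
  · intro b hb
    have := congrFun (LinearMap.mem_ker.1 hc) ⟨b, hb⟩
    simpa [L, aeval_eq_eval] using this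
  · by_contra! hcon
    refine hF0 (eq_zero_of_eval_zero_at_prod_finset _
      (fun i => (Finset.range (k i)).map (Nat.castEmbedding (R := ℝ))) ?_ ?_)
    · intro i
      obtain ⟨m, hm⟩ := support_nonempty.2 hF0
      obtain ⟨a, ha, -⟩ := hcoeff m hm
      rw [Finset.card_map, Finset.card_range, degreeOf_lt_iff (by have := hA a ha i; omega)]
      intro m hm
      obtain ⟨a, ha, hma⟩ := hcoeff m hm
      rw [hma]
      exact hA a ha i
    · intro x hx
      simp only [Finset.mem_map, Finset.mem_range, Nat.castEmbedding_apply] at hx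
      choose y hy hyx using hx
      have : x = toR y := funext fun i => (hyx i).symm
      rw [this]
      exact hcon y hy

theorem exists_proper_cover_T (hk : ∀ i, 2 ≤ k i) (hSU : SU2 n k) {M : ℕ}
    (hM : M ≤ Ntot n k / 2) :
    ∃ P : MvPolynomial (Fin n) ℝ, P.totalDegree ≤ M ∧
      (∀ j ∈ T (Ntot n k) M, layer n k j ⊆ ZG n k P) ∧
      ∀ j ≤ Ntot n k, j ∉ T (Ntot n k) M → ¬ layer n k j ⊆ ZG n k P := by
  set N := Ntot n k with hN
  have hlow : (layerFinset n k (N + 1 - M)).card < (layerFinset n k M).card := by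
    rcases Nat.eq_zero_or_pos M with rfl | hM0
    · have h1 : layerFinset n k (N + 1 - 0) = ∅ := by
        refine Finset.eq_empty_of_forall_notMem fun x hx => ?_
        obtain ⟨hx, hw⟩ := mem_layerFinset.1 hx
        have := wt_le_Ntot hx
        omega
      rw [h1, Finset.card_empty, Finset.card_pos]
      exact ⟨0, mem_layerFinset.2 ⟨fun i => by have := hk i; simp only [Pi.zero_apply]; omega,
        by simp [wt]⟩⟩
    · have h1 := card_layerFinset_sub (j := M - 1) hk (by omega)
      have h2 := hSU.1 (M - 1) (by omega)
      rw [ncard_layer, ncard_layer, Nat.sub_add_cancel hM0] at h2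
      rw [show N + 1 - M = Ntot n k - (M - 1) by omega]
      omega
  set G : Finset (Fin n → ℕ) := Fintype.piFinset fun i => Finset.range (k i) with hG
  have hmemG : ∀ x, x ∈ G ↔ x ∈ gridSet n k := fun x => by simp [hG, gridSet]
  have hcard : (G.filter (wt · ≤ M)).card = (G.filter (wt · < M)).card +
      (layerFinset n k M).card := by
    rw [layerFinset, ← Finset.card_union_of_disjoint]
    · congr 1
      ext x
      simp only [Finset.mem_union, Finset.mem_filter, ← hG, le_iff_lt_or_eq]
      tauto
    · refine Finset.disjoint_filter.2 fun x _ h1 h2 => by omega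
  obtain ⟨P, hPd, hPB, x, hx, hPx⟩ := exists_polynomial_vanish (G.filter (wt · ≤ M))
    (G.filter (wt · < M) ∪ layerFinset n k (N + 1 - M))
    (fun a ha => (hmemG a).1 (Finset.mem_filter.1 ha).1)
    (by have := Finset.card_union_le (G.filter (wt · < M)) (layerFinset n k (N + 1 - M)); omega)
    M (fun a ha => (Finset.mem_filter.1 ha).2)
  have hbot : ∀ t < M, layer n k t ⊆ ZG n k P := fun t ht y hy =>
    ⟨hy.1, hPB y (Finset.mem_union_left _ (Finset.mem_filter.2 ⟨(hmemG y).2 hy.1, hy.2 ▸ ht⟩))⟩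
  have hins : ∀ t, M ≤ t → layer n k t ⊆ ZG n k P → ∀ j, t ≤ j → layer n k j ⊆ ZG n k P := by
    intro t ht hlt j htj
    refine layer_subset_ZG_of_le hPd (A := insert t (Finset.range M)) ?_ ?_ ?_
    · rw [Finset.card_insert_of_notMem (by simpa using ht), Finset.card_range]
      omega
    · intro s hs
      rcases Finset.mem_insert.1 hs with rfl | hs
      · exact hlt
      · exact hbot s (Finset.mem_range.1 hs)
    · intro s hs
      rcases Finset.mem_insert.1 hs with rfl | hs
      · exact htj
      · have := Finset.mem_range.1 hs
        omega
  have htop : ∀ t, N - M + 1 ≤ t → layer n k t ⊆ ZG n k P := fun t ht =>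
    hins (N + 1 - M) (by omega) (fun y hy =>
      ⟨hy.1, hPB y (Finset.mem_union_right _ (mem_layerFinset.2 hy))⟩) t (by omega)
  refine ⟨P, hPd, ?_, ?_⟩
  · intro j hj
    rcases Finset.mem_union.1 hj with hj | hj
    · exact hbot j (Finset.mem_range.1 hj)
    · exact htop j (Finset.mem_Icc.1 hj).1
  · intro j hjN hj hjP
    have hj' : M ≤ j ∧ j ≤ N - M := by
      simp only [T, Finset.mem_union, Finset.mem_range, Finset.mem_Icc] at hj
      omega
    refine hPx (?_ : x ∈ ZG n k P).2
    rcases le_total j (wt x) with hjx | hxj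
    · exact hins j hj'.1 hjP _ hjx ⟨hx, rfl⟩
    · refine layer_subset_ZG_of_ge hk hPd (A := insert j (Finset.Icc (N - M + 1) N))
        (j := wt x) ?_ ?_ ?_ ?_ ⟨hx, rfl⟩
      · rw [Finset.card_insert_of_notMem (by simp only [Finset.mem_Icc]; omega), Nat.card_Icc]
        omega
      · intro s hs
        rcases Finset.mem_insert.1 hs with rfl | hs
        · exact hjP
        · exact htop s (Finset.mem_Icc.1 hs).1
      · intro s hs
        rcases Finset.mem_insert.1 hs with rfl | hs
        · exact hjN
        · exact (Finset.mem_Icc.1 hs).2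
      · intro s hs
        rcases Finset.mem_insert.1 hs with rfl | hs
        · exact hxj
        · have := (Finset.mem_Icc.1 hs).1
          omega

theorem card_T {N i : ℕ} (hi : i ≤ N / 2) : (T N i).card = 2 * i := by
  rw [T, Finset.card_union_of_disjoint, Finset.card_range, Nat.card_Icc]
  · omega
  · refine Finset.disjoint_left.2 fun x hx hx' => ?_
    simp only [Finset.mem_range, Finset.mem_Icc] at hx hx'
    omega

theorem exists_proper_cover (hk : ∀ i, 2 ≤ k i) (hSU : SU2 n k) {E : Finset ℕ} {M : ℕ}
    (hM : M ≤ Ntot n k / 2) (hT : T (Ntot n k) M ⊆ E) :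
    ∃ P : MvPolynomial (Fin n) ℝ, P.totalDegree ≤ E.card - M ∧ wdSet n k E ⊆ ZG n k P ∧
      ∀ j ≤ Ntot n k, j ∉ E → ¬ layer n k j ⊆ ZG n k P := by
  obtain ⟨Q, hQd, hQT, hQ⟩ := exists_proper_cover_T hk hSU hM
  set R : MvPolynomial (Fin n) ℝ :=
    ∏ e ∈ E \ T (Ntot n k) M, ((∑ i, X i) - C (e : ℝ)) with hR
  have heval : ∀ x, eval (toR x) R =
      ∏ e ∈ E \ T (Ntot n k) M, ((wt x : ℝ) - (e : ℝ)) := fun x => by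
    simp [hR, map_prod, toR, wt]
  refine ⟨Q * R, ?_, ?_, ?_⟩
  · have hRd : R.totalDegree ≤ (E \ T (Ntot n k) M).card := by
      refine (totalDegree_finsetProd _ _).trans ?_
      rw [Finset.card_eq_sum_ones]
      refine Finset.sum_le_sum fun e _ => (totalDegree_sub_C_le _ _).trans ?_
      exact totalDegree_finsetSum_le fun i _ => (totalDegree_X i).le
    have h1 := Finset.card_sdiff_add_card_eq_card hT
    rw [card_T hM] at h1
    have := totalDegree_mul Q R
    omega
  · rintro x ⟨hx, hxE⟩
    refine ⟨hx, ?_⟩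
    rw [eval_mul]
    by_cases hxT : wt x ∈ T (Ntot n k) M
    · rw [(hQT _ hxT ⟨hx, rfl⟩).2, zero_mul]
    · rw [heval, Finset.prod_eq_zero (Finset.mem_sdiff.2 ⟨hxE, hxT⟩) (sub_self _), mul_zero]
  · intro j hj hjE hjP
    refine hQ j hj (fun h => hjE (hT h)) fun x hx => ⟨hx.1, ?_⟩
    have h1 := (hjP hx).2
    rw [eval_mul, heval] at h1
    refine (mul_eq_zero.1 h1).resolve_right (Finset.prod_ne_zero_iff.2 fun e he => ?_)
    rw [hx.2, sub_ne_zero, Ne, Nat.cast_inj]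
    rintro rfl
    exact hjE (Finset.mem_sdiff.1 he).1

theorem exists_T_subset_card_le (hk : ∀ i, 2 ≤ k i) {E : Finset ℕ}
    (hE : E ⊂ Finset.range (Ntot n k + 1)) {P : MvPolynomial (Fin n) ℝ}
    (hPE : wdSet n k E ⊆ ZG n k P) (hP : ∀ j ≤ Ntot n k, j ∉ E → ¬ layer n k j ⊆ ZG n k P) :
    ∃ i ≤ Ntot n k / 2, T (Ntot n k) i ⊆ E ∧ E.card ≤ P.totalDegree + i := by
  set N := Ntot n k with hN
  have hEN : ∀ t ∈ E, t ≤ N := fun t ht => Nat.le_of_lt_succ (Finset.mem_range.1 (hE.1 ht))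
  have hlay : ∀ t ∈ E, layer n k t ⊆ ZG n k P := fun t ht x hx => hPE ⟨hx.1, hx.2 ▸ ht⟩
  obtain ⟨j₀, hj₀, hj₀E⟩ := Finset.exists_of_ssubset hE
  set H := Finset.range (N + 1) \ E with hH
  have hHne : H.Nonempty := ⟨j₀, Finset.mem_sdiff.2 ⟨hj₀, hj₀E⟩⟩
  have hHmem : ∀ t, t ∈ H ↔ t ≤ N ∧ t ∉ E := fun t => by
    rw [hH, Finset.mem_sdiff, Finset.mem_range, Nat.lt_succ_iff]
  set a := H.min' hHne
  set b := H.max' hHne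
  have ha := (hHmem a).1 (H.min'_mem hHne)
  have hb := (hHmem b).1 (H.max'_mem hHne)
  have hab : a ≤ b := H.min'_le _ (H.max'_mem hHne)
  have h1 : E.card ≤ P.totalDegree + a := by
    by_contra! hlt
    refine hP a ha.1 ha.2 (layer_subset_ZG_of_ge hk le_rfl (A := E \ Finset.range a) ?_ ?_ ?_ ?_)
    · have := Finset.le_card_sdiff (Finset.range a) E
      rw [Finset.card_range] at this
      omega
    · exact fun t ht => hlay t (Finset.mem_sdiff.1 ht).1
    · exact fun t ht => hEN t (Finset.mem_sdiff.1 ht).1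
    · exact fun t ht => by simpa using (Finset.mem_sdiff.1 ht).2
  have h2 : E.card ≤ P.totalDegree + (N - b) := by
    by_contra! hlt
    refine hP b hb.1 hb.2 (layer_subset_ZG_of_le le_rfl (A := E \ Finset.Icc (b + 1) N) ?_ ?_ ?_)
    · have := Finset.le_card_sdiff (Finset.Icc (b + 1) N) E
      rw [Nat.card_Icc] at this
      omega
    · exact fun t ht => hlay t (Finset.mem_sdiff.1 ht).1
    · intro t ht
      obtain ⟨htE, htb⟩ := Finset.mem_sdiff.1 ht
      have := hEN t htE
      rw [Finset.mem_Icc] at htb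
      omega
  refine ⟨min a (N - b), by omega, fun t ht => ?_, by omega⟩
  by_contra htE
  simp only [T, Finset.mem_union, Finset.mem_range, Finset.mem_Icc] at ht
  have htH : t ∈ H := (hHmem t).2 ⟨by omega, htE⟩
  have := H.min'_le t htH
  have := H.le_max' t htH
  omega

end Grid

/-- for an SU² grid, `PPC_G(E) = |E| - max{i ∈ [0,⌊N/2⌋] : T_{N,i} ⊆ E}`. -/
theorem stmt2 (n : ℕ) (hn : 1 ≤ n) (k : Fin n → ℕ) (hk : ∀ i, 2 ≤ k i) (hSU : SU2 n k)
    (E : Finset ℕ) (hE : E ⊂ Finset.range (Ntot n k + 1)) :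
    PPC n k E = E.card - sSup {i | i ≤ Ntot n k / 2 ∧ T (Ntot n k) i ⊆ E} := by
  set A := {i | i ≤ Ntot n k / 2 ∧ T (Ntot n k) i ⊆ E} with hA
  have hbdd : BddAbove A := ⟨Ntot n k / 2, fun i hi => hi.1⟩
  have hmem : sSup A ∈ A := Nat.sSup_mem ⟨0, by simp [hA, T]⟩ hbdd
  obtain ⟨P, hPd, hPE, hP⟩ := exists_proper_cover hk hSU hmem.1 hmem.2
  refine le_antisymm (le_trans (Nat.sInf_le ⟨P, rfl, hPE, hP⟩) hPd) ?_
  refine le_csInf ⟨P.totalDegree, P, rfl, hPE, hP⟩ ?_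
  rintro _ ⟨Q, rfl, hQE, hQ⟩
  obtain ⟨i, hi, hiE, hcard⟩ := exists_T_subset_card_le hk hE hQE hQ
  have := le_csSup hbdd (show i ∈ A from ⟨hi, hiE⟩)
  omega

end CoveringSymmetric
end
end
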